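/- arXiv:1504.04470 — 3 statements merged into one kernel-verified Lean document; each statement's English description precedes it below -/
import Mathlib

section
/- Let G be a proper Helly circular-arc graph that is not chordal, and let A be an arc model for G. A set S of vertices is such that the arcs {A(v) : v ∈ S} cover the whole circle while the arcs of no proper subset of S cover the whole circle, if and only if S induces a hole of G. -/
/-- A unit interval graph: vertices can be mapped to reals so that two distinct
vertices are adjacent iff their images are within distance 1. -/
def SimpleGraph.IsUnitIntervalGraph {V : Type*} (G : SimpleGraph V) : Prop :=
  ∃ f : V → ℝ, ∀ u v : V, u ≠ v → (G.Adj u v ↔ |f u - f v| ≤ 1)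

/-- `f : ZMod n → V` describes a hole (induced cycle of length `n ≥ 4`) of `G`. -/
def SimpleGraph.IsHoleOn {V : Type*} (G : SimpleGraph V) (n : ℕ) (f : ZMod n → V) : Prop :=
  4 ≤ n ∧ Function.Injective f ∧
    ∀ i j : ZMod n, (G.Adj (f i) (f j) ↔ (i = j + 1 ∨ j = i + 1))

def SimpleGraph.HasHole {V : Type*} (G : SimpleGraph V) : Prop :=
  ∃ (n : ℕ) (f : ZMod n → V), G.IsHoleOn n f

/-- A graph is chordal if it has no hole. -/
def SimpleGraph.Chordal {V : Type*} (G : SimpleGraph V) : Prop := ¬ G.HasHole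

/-- `G` contains an induced copy of `H`. -/
def SimpleGraph.HasInducedCopy {V W : Type*} (G : SimpleGraph V) (H : SimpleGraph W) : Prop :=
  ∃ f : W → V, Function.Injective f ∧ ∀ a b : W, G.Adj (f a) (f b) ↔ H.Adj a b

/-- The claw `K_{1,3}`, centered at vertex `0`. -/
def clawGraph : SimpleGraph (Fin 4) := SimpleGraph.fromRel (fun a _ => a = 0)

/-- The tent `S_3`: triangle on `0,1,2`; vertex `i+3` adjacent to `{0,1,2} \ {i}`. -/
def tentGraph : SimpleGraph (Fin 6) := SimpleGraph.fromRel (fun a b =>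
  (a.val < 3 ∧ b.val < 3) ∨ (a.val < 3 ∧ 3 ≤ b.val ∧ b.val ≠ a.val + 3))

/-- The net: triangle on `0,1,2`; pendant vertex `i+3` adjacent exactly to `i`. -/
def netGraph : SimpleGraph (Fin 6) := SimpleGraph.fromRel (fun a b =>
  (a.val < 3 ∧ b.val < 3) ∨ (a.val < 3 ∧ b.val = a.val + 3))

/-- The cycle `C_n` on `ZMod n`. -/
def cycleG (n : ℕ) : SimpleGraph (ZMod n) := SimpleGraph.fromRel (fun a b => a = b + 1)

/-- The wheel `W_n`: a cycle `C_n` plus a hub (`none`) adjacent to all cycle vertices. -/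
def wheelG (n : ℕ) : SimpleGraph (Option (ZMod n)) := SimpleGraph.fromRel (fun a b =>
  a = none ∨ ∃ i j : ZMod n, a = some i ∧ b = some j ∧ i = j + 1)

/-- `C*_n`: a cycle `C_n` plus an isolated vertex (`none`). -/
def cycleStarG (n : ℕ) : SimpleGraph (Option (ZMod n)) := SimpleGraph.fromRel (fun a b =>
  ∃ i j : ZMod n, a = some i ∧ b = some j ∧ i = j + 1)

/-- Raw data of a family of closed arcs on the circle `ℝ/Lℤ`: each vertex `v` gets the
arc traversed clockwise from (the image of) `src v` to `src v + len v`. -/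
structure PreArcModel (V : Type*) where
  L : ℝ
  L_pos : 0 < L
  src : V → ℝ
  len : V → ℝ
  len_pos : ∀ v, 0 < len v
  len_lt : ∀ v, len v < L

namespace PreArcModel

variable {V : Type*}

/-- The counterclockwise endpoint of the arc of `v`. -/
noncomputable def ccp (A : PreArcModel V) (v : V) : AddCircle A.L := (A.src v : ℝ)

/-- The clockwise endpoint of the arc of `v`. -/
noncomputable def cp (A : PreArcModel V) (v : V) : AddCircle A.L :=
  ((A.src v + A.len v : ℝ) : AddCircle A.L)

/-- The closed arc assigned to `v`, as a subset of the circle. -/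
noncomputable def arc (A : PreArcModel V) (v : V) : Set (AddCircle A.L) :=
  (fun x : ℝ => (x : AddCircle A.L)) '' Set.Icc (A.src v) (A.src v + A.len v)

/-- All endpoints of all arcs are pairwise distinct. -/
def EndpointsDistinct (A : PreArcModel V) : Prop :=
  Function.Injective (fun p : V × Bool => if p.2 then A.cp p.1 else A.ccp p.1)

/-- `A` is an arc model of the graph `G`: endpoints are pairwise distinct and two
distinct vertices are adjacent iff their arcs intersect. -/
def IsModelOf (A : PreArcModel V) (G : SimpleGraph V) : Prop :=
  A.EndpointsDistinct ∧ ∀ u v : V, u ≠ v → (G.Adj u v ↔ (A.arc u ∩ A.arc v).Nonempty)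

/-- No arc is properly contained in another arc. -/
def Proper (A : PreArcModel V) : Prop := ∀ u v : V, ¬ A.arc u ⊂ A.arc v

/-- Every set of pairwise intersecting arcs has a common point. -/
def Helly (A : PreArcModel V) : Prop :=
  ∀ S : Set V, (∀ u ∈ S, ∀ v ∈ S, (A.arc u ∩ A.arc v).Nonempty) →
    (⋂ v ∈ S, A.arc v).Nonempty

/-- The set `K_A(α)` of vertices whose arc contains the point `α`. -/
noncomputable def K (A : PreArcModel V) (α : AddCircle A.L) : Set V := {v | α ∈ A.arc v}

/-- The edge set `E→_A(α)`: edges `vu` of `G` with `v ∈ K_A(α)`, `u ∉ K_A(α)`,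
and `A(v)` intersecting `A(u)` from the left (`cp v ∈ A(u)`). -/
noncomputable def Eout (A : PreArcModel V) (G : SimpleGraph V) (α : AddCircle A.L) :
    Set (Sym2 V) :=
  {e | ∃ v u : V, e = s(v, u) ∧ G.Adj v u ∧ α ∈ A.arc v ∧ α ∉ A.arc u ∧ A.cp v ∈ A.arc u}

/-- The edge set `E→_{A - Vm}(α)` of the model obtained by removing the arcs of `Vm`. -/
noncomputable def EoutAvoid (A : PreArcModel V) (G : SimpleGraph V) (Vm : Set V)
    (α : AddCircle A.L) : Set (Sym2 V) :=
  {e | ∃ v u : V, e = s(v, u) ∧ G.Adj v u ∧ v ∉ Vm ∧ u ∉ Vm ∧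
    α ∈ A.arc v ∧ α ∉ A.arc u ∧ A.cp v ∈ A.arc u}

end PreArcModel

/-- A proper Helly circular-arc graph: a graph admitting an arc model that is both
proper and Helly. -/
def SimpleGraph.IsPHCA {V : Type*} (G : SimpleGraph V) : Prop :=
  ∃ A : PreArcModel V, A.IsModelOf G ∧ A.Proper ∧ A.Helly

/-- Adjacency pattern of a fat `W_5` among the six clique-classes: classes `0..4`
form the fat hole (consecutive classes modulo 5 are completely adjacent), class `5`
is the hub (completely adjacent to everything), and each class is a clique. -/
def fatW5Rel (p q : Fin 6) : Prop :=
  p = q ∨ p = 5 ∨ q = 5 ∨ (p.val + 1) % 5 = q.val ∨ (q.val + 1) % 5 = p.val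

/-- A fat `W_5`: vertex set partitioned into six nonempty cliques with the `W_5`
adjacency pattern between the classes. -/
def SimpleGraph.IsFatW5 {V : Type*} (G : SimpleGraph V) : Prop :=
  ∃ part : V → Fin 6, Function.Surjective part ∧
    ∀ u v : V, u ≠ v → (G.Adj u v ↔ fatW5Rel (part u) (part v))

/-- `Gb` is a maximum spanning unit interval subgraph of `G`. -/
def IsMaxSpanningUIG {V : Type*} (G Gb : SimpleGraph V) : Prop :=
  Gb ≤ G ∧ Gb.IsUnitIntervalGraph ∧
    ∀ H : SimpleGraph V, H ≤ G → H.IsUnitIntervalGraph →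
      H.edgeSet.ncard ≤ Gb.edgeSet.ncard

/-- `(Vm, Em, Ep)` is an editing set of `G`: `Em` is a set of edges of `G - Vm`,
`Ep` a set of non-edges of `G - Vm`, and deleting `Em` and adding `Ep` makes
`G - Vm` a unit interval graph. -/
def IsEditingSet {V : Type*} (G : SimpleGraph V) (Vm : Set V) (Em Ep : Set (Sym2 V)) : Prop :=
  Em ⊆ G.edgeSet ∧ (∀ e ∈ Em, ∀ x ∈ e, x ∉ Vm) ∧
  (∀ e ∈ Ep, ¬ e.IsDiag ∧ e ∉ G.edgeSet ∧ ∀ x ∈ e, x ∉ Vm) ∧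
  ((SimpleGraph.fromEdgeSet ((G.edgeSet \ Em) ∪ Ep)).induce {v | v ∉ Vm}).IsUnitIntervalGraph


/-- A subset of the circle is arc-like if membership in it never alternates along four
cyclically ordered points. -/
def AddCircle.IsArcLike {L : ℝ} (X : Set (AddCircle L)) : Prop :=
  ∀ ⦃a b c d : ℝ⦄, a < b → b < c → c < d → d < a + L →
    (a : AddCircle L) ∈ X → (b : AddCircle L) ∉ X → (c : AddCircle L) ∈ X →
    (d : AddCircle L) ∈ X

namespace AddCircle

variable {L : ℝ}

theorem exists_mem_Ico_coe_eq (hL : 0 < L) (a : ℝ) (z : AddCircle L) :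
    ∃ t ∈ Set.Ico a (a + L), (t : AddCircle L) = z := by
  have : Fact (0 < L) := ⟨hL⟩
  have h := AddCircle.coe_image_Ico_eq L a
  have hz : z ∈ ((↑) : ℝ → AddCircle L) '' Set.Ico a (a + L) := h ▸ Set.mem_univ z
  exact hz

/-- Two arc-like sets whose distinguished points are separated on both sides by points outside
both sets are disjoint. -/
theorem IsArcLike.disjoint_of_separated (hL : 0 < L) {X Y : Set (AddCircle L)}
    (hX : IsArcLike X) (hY : IsArcLike Y) {a b c d : ℝ}
    (hac : a < c) (hcb : c < b) (hbd : b < d) (hda : d < a + L)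
    (haX : (a : AddCircle L) ∈ X) (haY : (a : AddCircle L) ∉ Y)
    (hbX : (b : AddCircle L) ∉ X) (hbY : (b : AddCircle L) ∈ Y)
    (hcX : (c : AddCircle L) ∉ X) (hcY : (c : AddCircle L) ∉ Y)
    (hdX : (d : AddCircle L) ∉ X) (hdY : (d : AddCircle L) ∉ Y) : Disjoint X Y := by
  rw [Set.disjoint_left]
  intro z hzX hzY
  obtain ⟨t, ⟨hat, hta⟩, rfl⟩ := exists_mem_Ico_coe_eq hL a z
  rcases hat.eq_or_lt with rfl | hat
  · exact haY hzY
  rcases lt_trichotomy t c with htc | rfl | hct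
  · exact hdY (hY htc hcb hbd (by linarith) hzY hcY hbY)
  · exact hcX hzX
  rcases lt_trichotomy t b with htb | rfl | hbt
  · exact hbX (hX hac hct htb (by linarith) haX hcX hzX)
  · exact hbX hzX
  rcases lt_trichotomy t d with htd | rfl | hdt
  · exact hdX (hX hac hct htd hda haX hcX hzX)
  · exact hdX hzX
  · have h := hY hbd hdt (show t < c + L by linarith) (by linarith) hbY hdY hzY
    rw [AddCircle.coe_add_period] at h
    exact hcY h

/-- Intervals of a linear order cannot realize a cyclic intersection pattern. -/
theorem not_ordConnected_cycle {n : ℕ} [NeZero n] (I : ZMod n → Set ℝ)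
    (hI : ∀ i, (I i).OrdConnected) (hdisj : ∀ i, Disjoint (I i) (I (i + 2)))
    (hmeet : ∀ i, (I i ∩ I (i + 1)).Nonempty) : False := by
  choose x hx using hmeet
  obtain ⟨m, hm⟩ := Finite.exists_max x
  have h₁ := hx (m - 1)
  have h₂ := hx (m + 1)
  rw [sub_add_cancel] at h₁
  rw [show m + 1 + 1 = m + 2 by ring] at h₂
  rcases le_total (x (m - 1)) (x (m + 1)) with h | h
  · exact Set.disjoint_left.1 (hdisj m) ((hI m).out h₁.2 (hx m).1 ⟨h, hm _⟩) h₂.2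
  · have := hdisj (m - 1)
    rw [show m - 1 + 2 = m + 1 by ring] at this
    exact Set.disjoint_left.1 this h₁.1 ((hI (m + 1)).out h₂.1 (hx m).2 ⟨h, hm _⟩)

/-- Arc-like sets missing a common point cannot realize a cyclic intersection pattern. -/
theorem IsArcLike.cover_of_cycle (hL : 0 < L) {n : ℕ} [NeZero n] {h : ZMod n → Set (AddCircle L)}
    (harc : ∀ i, IsArcLike (h i)) (hdisj : ∀ i, Disjoint (h i) (h (i + 2)))
    (hmeet : ∀ i, (h i ∩ h (i + 1)).Nonempty) : ⋃ i, h i = Set.univ := by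
  by_contra hcov
  obtain ⟨g, hg⟩ := (Set.ne_univ_iff_exists_notMem _).1 hcov
  simp only [Set.mem_iUnion, not_exists] at hg
  obtain ⟨g₀, -, rfl⟩ := exists_mem_Ico_coe_eq hL 0 g
  refine not_ordConnected_cycle
    (fun i ↦ {t : ℝ | t ∈ Set.Ico g₀ (g₀ + L) ∧ (t : AddCircle L) ∈ h i}) ?_ ?_ ?_
  · refine fun i ↦ ⟨?_⟩
    rintro a ⟨ha, hai⟩ c ⟨hc, hci⟩ b ⟨hab, hbc⟩
    refine ⟨⟨ha.1.trans hab, hbc.trans_lt hc.2⟩, ?_⟩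
    rcases hab.eq_or_lt with rfl | hab
    · exact hai
    rcases hbc.eq_or_lt with rfl | hbc
    · exact hci
    have hga : g₀ ≠ a := by
      rintro rfl
      exact hg i hai
    by_contra hb
    have := harc i hab hbc hc.2 (by linarith [lt_of_le_of_ne ha.1 hga]) hai hb hci
    rw [AddCircle.coe_add_period] at this
    exact hg i this
  · intro i
    rw [Set.disjoint_left]
    rintro t ⟨-, ht⟩ ⟨-, ht'⟩
    exact Set.disjoint_left.1 (hdisj i) ht ht'
  · intro i
    obtain ⟨z, hz, hz'⟩ := hmeet i
    obtain ⟨t, ht, rfl⟩ := exists_mem_Ico_coe_eq hL g₀ z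
    exact ⟨t, ⟨ht, hz⟩, ht, hz'⟩

/-- If arc-like sets through a common point, all missing another point, touch every link of a
cycle of arc-like sets, then two of them cover the circle together with a member of the cycle. -/
theorem IsArcLike.exists_cover_of_cycle (hL : 0 < L) {n : ℕ} [NeZero n]
    {h : ZMod n → Set (AddCircle L)}
    (harc : ∀ i, IsArcLike (h i)) (hdisj : ∀ i, Disjoint (h i) (h (i + 2)))
    {ι : Type*} {S : Set ι} {F : ι → Set (AddCircle L)} (hF : ∀ x ∈ S, IsArcLike (F x))
    {p g : AddCircle L} (hp : ∀ x ∈ S, p ∈ F x) (hg : ∀ x ∈ S, g ∉ F x)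
    (hmeet : ∀ i, ∃ x ∈ S, (h i ∩ h (i + 1) ∩ F x).Nonempty) :
    ∃ i, ∃ x ∈ S, ∃ y ∈ S, (F x ∩ h i).Nonempty ∧ (F y ∩ h i).Nonempty ∧
      F x ∪ F y ∪ h i = Set.univ := by
  by_contra hcon
  push Not at hcon
  obtain ⟨g₀, -, rfl⟩ := exists_mem_Ico_coe_eq hL 0 g
  obtain ⟨p₀, ⟨hgp, hpg⟩, rfl⟩ := exists_mem_Ico_coe_eq hL g₀ p
  refine not_ordConnected_cycle (fun i ↦ {t : ℝ | t ∈ Set.Ico g₀ (g₀ + L) ∧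
    (t : AddCircle L) ∈ h i ∧ ∃ x ∈ S, (t : AddCircle L) ∈ F x}) ?_ ?_ ?_
  · refine fun i ↦ ⟨?_⟩
    rintro a ⟨ha, hai, x, hx, hax⟩ c ⟨hc, hci, y, hy, hcy⟩ b ⟨hab, hbc⟩
    have hga : g₀ < a := by
      refine lt_of_le_of_ne ha.1 ?_
      rintro rfl
      exact hg x hx hax
    have hgp' : g₀ < p₀ := by
      refine lt_of_le_of_ne hgp ?_
      rintro rfl
      exact hg x hx (hp x hx)
    have hcov : ∀ t ∈ Set.Icc a c, (t : AddCircle L) ∈ F x ∨ (t : AddCircle L) ∈ F y := by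
      rintro t ⟨hat, htc⟩
      rcases le_total t p₀ with htp | hpt
      · left
        rcases hat.eq_or_lt with rfl | hat
        · exact hax
        rcases htp.eq_or_lt with rfl | htp
        · exact hp x hx
        by_contra ht
        have := hF x hx hat htp hpg (by linarith) hax ht (hp x hx)
        rw [AddCircle.coe_add_period] at this
        exact hg x hx this
      · right
        rcases htc.eq_or_lt with rfl | htc
        · exact hcy
        rcases hpt.eq_or_lt with rfl | hpt
        · exact hp y hy
        by_contra ht
        have := hF y hy hpt htc hc.2 (by linarith) (hp y hy) ht hcy
        rw [AddCircle.coe_add_period] at this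
        exact hg y hy this
    refine ⟨⟨ha.1.trans hab, hbc.trans_lt hc.2⟩, ?_, ?_⟩
    · rcases hab.eq_or_lt with rfl | hab'
      · exact hai
      rcases hbc.eq_or_lt with rfl | hbc'
      · exact hci
      by_contra hb
      refine hcon i x hx y hy ⟨_, hax, hai⟩ ⟨_, hcy, hci⟩ (Set.eq_univ_of_forall fun z ↦ ?_)
      obtain ⟨t, ⟨hgt, htg⟩, rfl⟩ := exists_mem_Ico_coe_eq hL g₀ z
      rcases lt_or_ge t a with hta | hat
      · right
        have := harc i hab' hbc' (show c < t + L by linarith [hc.2]) (by linarith) hai hb hci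
        rwa [AddCircle.coe_add_period] at this
      rcases lt_or_ge c t with hct | htc
      · right
        exact harc i hab' hbc' hct (by linarith) hai hb hci
      · left
        exact hcov t ⟨hat, htc⟩
    · rcases hcov b ⟨hab, hbc⟩ with hb | hb
      · exact ⟨x, hx, hb⟩
      · exact ⟨y, hy, hb⟩
  · intro i
    rw [Set.disjoint_left]
    rintro t ⟨-, ht, -⟩ ⟨-, ht', -⟩
    exact Set.disjoint_left.1 (hdisj i) ht ht'
  · intro i
    obtain ⟨x, hx, z, ⟨hz, hz'⟩, hzx⟩ := hmeet i
    obtain ⟨t, ht, rfl⟩ := exists_mem_Ico_coe_eq hL g₀ z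
    exact ⟨t, ⟨ht, hz, x, hx, hzx⟩, ht, hz', x, hx, hzx⟩

/-- Finitely many arc-like sets through a common point, no two of which cover the circle, do not
cover the circle. -/
theorem IsArcLike.exists_notMem_of_pairwise (hL : 0 < L) {ι : Type*} {S : Set ι} (hS : S.Finite)
    {F : ι → Set (AddCircle L)} (hF : ∀ x ∈ S, IsArcLike (F x)) {p : AddCircle L}
    (hp : ∀ x ∈ S, p ∈ F x) (hpair : ∀ x ∈ S, ∀ y ∈ S, F x ∪ F y ≠ Set.univ) :
    ∃ g, ∀ x ∈ S, g ∉ F x := by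
  obtain ⟨p₀, -, rfl⟩ := exists_mem_Ico_coe_eq hL 0 p
  let C : ι → Set ℝ := fun x ↦ {t | t ∈ Set.Ico p₀ (p₀ + L) ∧ (t : AddCircle L) ∉ F x}
  have hC : ∀ x ∈ S, ∀ y ∈ S, (C x ∩ C y).Nonempty := by
    intro x hx y hy
    obtain ⟨z, hz⟩ := (Set.ne_univ_iff_exists_notMem _).1 (hpair x hx y hy)
    obtain ⟨t, ht, rfl⟩ := exists_mem_Ico_coe_eq hL p₀ z
    rw [Set.mem_union, not_or] at hz
    exact ⟨t, ⟨ht, hz.1⟩, ht, hz.2⟩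
  have hne : (⋂ x ∈ hS.toFinset, C x).Nonempty := by
    refine Convex.helly_theorem' (𝕜 := ℝ) (fun x hx ↦ ?_) (fun I hI hcard ↦ ?_)
    · rw [Set.Finite.mem_toFinset] at hx
      refine Set.OrdConnected.convex ⟨?_⟩
      rintro a ⟨ha, hax⟩ c ⟨hc, hcx⟩ b ⟨hab, hbc⟩
      refine ⟨⟨ha.1.trans hab, hbc.trans_lt hc.2⟩, fun hb ↦ ?_⟩
      rcases hab.eq_or_lt with rfl | hab
      · exact hax hb
      rcases hbc.eq_or_lt with rfl | hbc
      · exact hcx hb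
      have hpa : p₀ < a := by
        refine lt_of_le_of_ne ha.1 ?_
        rintro rfl
        exact hax (hp x hx)
      exact hcx (hF x hx hpa hab hbc hc.2 (hp x hx) hax hb)
    · rw [Module.finrank_self] at hcard
      have hIS : ∀ x ∈ I, x ∈ S := fun x hx ↦ by simpa using hI hx
      rcases I.eq_empty_or_nonempty with rfl | hI'
      · simp
      · have h12 : I.card = 1 ∨ I.card = 2 := by
          have := hI'.card_pos
          omega
        rcases h12 with h1 | h2
        · obtain ⟨x, rfl⟩ := Finset.card_eq_one.1 h1
          simpa using hC x (hIS x (by simp)) x (hIS x (by simp))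
        · classical
          obtain ⟨x, y, -, rfl⟩ := Finset.card_eq_two.1 h2
          simpa using hC x (hIS x (by simp)) y (hIS y (by simp))
  obtain ⟨t, ht⟩ := hne
  simp only [Set.Finite.mem_toFinset, Set.mem_iInter] at ht
  exact ⟨t, fun x hx ↦ (ht x hx).2⟩

end AddCircle

namespace PreArcModel

open AddCircle

variable {V : Type*} (A : PreArcModel V)

theorem coe_mem_arc_iff (v : V) (x : ℝ) :
    (x : AddCircle A.L) ∈ A.arc v ↔
      ∃ k : ℤ, A.src v ≤ x + k * A.L ∧ x + k * A.L ≤ A.src v + A.len v := by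
  constructor
  · rintro ⟨y, hy, hyx⟩
    obtain ⟨k, hk⟩ := AddSubgroup.mem_zmultiples_iff.1 (QuotientAddGroup.eq.1 hyx.symm)
    rw [zsmul_eq_mul] at hk
    have : y = x + k * A.L := by linarith
    exact ⟨k, this ▸ hy.1, this ▸ hy.2⟩
  · rintro ⟨k, hk⟩
    refine ⟨x + k * A.L, hk, ?_⟩
    simp [← zsmul_eq_mul]

theorem isArcLike_arc (v : V) : IsArcLike (A.arc v) := by
  intro a b c d hab hbc hcd hda ha hb hc
  rw [coe_mem_arc_iff] at ha hb hc ⊢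
  obtain ⟨k, hk⟩ := ha
  obtain ⟨m, hm⟩ := hc
  push Not at hb
  have hL := A.L_pos
  rcases le_or_gt k m with hkm | hkm
  · rcases hkm.eq_or_lt with rfl | hkm
    · linarith [hb k (by linarith)]
    · have h : ((k : ℝ) + 1) * A.L ≤ m * A.L := by
        have : (k : ℝ) + 1 ≤ m := by exact_mod_cast hkm
        gcongr
      exact ⟨k, by linarith, by linarith⟩
  · have h : ((m : ℝ) + 1) * A.L ≤ k * A.L := by
      have : (m : ℝ) + 1 ≤ k := by exact_mod_cast hkm
      gcongr
    exact ⟨m, by linarith, by linarith⟩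

theorem isClosed_arc (v : V) : IsClosed (A.arc v) := by
  have : Fact (0 < A.L) := ⟨A.L_pos⟩
  exact (isCompact_Icc.image (AddCircle.continuous_mk' A.L)).isClosed

theorem isPreconnected_arc (v : V) : IsPreconnected (A.arc v) :=
  isPreconnected_Icc.image _ (AddCircle.continuous_mk' A.L).continuousOn

theorem arc_nonempty (v : V) : (A.arc v).Nonempty :=
  ⟨_, A.src v, ⟨le_rfl, by linarith [A.len_pos v]⟩, rfl⟩

theorem inter_nonempty_of_union_eq_univ {u v : V} (h : A.arc u ∪ A.arc v = Set.univ) :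
    (A.arc u ∩ A.arc v).Nonempty := by
  have : Fact (0 < A.L) := ⟨A.L_pos⟩
  have := isPreconnected_closed_iff.1 (isPreconnected_univ (α := AddCircle A.L)) _ _
    (A.isClosed_arc u) (A.isClosed_arc v) h.ge
    (by simpa using A.arc_nonempty u) (by simpa using A.arc_nonempty v)
  simpa using this

variable {A} {G : SimpleGraph V}

theorem Helly.exists_mem_triple (hH : A.Helly) {u v w : V} (huv : (A.arc u ∩ A.arc v).Nonempty)
    (huw : (A.arc u ∩ A.arc w).Nonempty) (hvw : (A.arc v ∩ A.arc w).Nonempty) :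
    ∃ p, p ∈ A.arc u ∧ p ∈ A.arc v ∧ p ∈ A.arc w := by
  have hne := A.arc_nonempty
  obtain ⟨p, hp⟩ := hH {u, v, w} (by
    rintro x (rfl | rfl | rfl) y (rfl | rfl | rfl) <;>
      first
        | assumption
        | (rw [Set.inter_comm]; assumption)
        | (rw [Set.inter_self]; exact hne _))
  simp only [Set.mem_iInter] at hp
  exact ⟨p, hp u (by simp), hp v (by simp), hp w (by simp)⟩

theorem IsModelOf.inter_nonempty (hA : A.IsModelOf G) {u v : V} (h : u = v ∨ G.Adj u v) :
    (A.arc u ∩ A.arc v).Nonempty := by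
  rcases h with rfl | h
  · simpa using A.arc_nonempty u
  · exact (hA.2 u v h.ne).1 h

theorem IsModelOf.eq_or_adj (hA : A.IsModelOf G) {u v : V} (h : (A.arc u ∩ A.arc v).Nonempty) :
    u = v ∨ G.Adj u v := by
  by_cases huv : u = v
  · exact Or.inl huv
  · exact Or.inr ((hA.2 u v huv).2 h)

section Hole

variable {n : ℕ} {f : ZMod n → V}

theorem _root_.SimpleGraph.IsHoleOn.neZero (hf : G.IsHoleOn n f) : NeZero n :=
  ⟨by have := hf.1; omega⟩

theorem _root_.SimpleGraph.IsHoleOn.adj_succ (hf : G.IsHoleOn n f) (i : ZMod n) :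
    G.Adj (f i) (f (i + 1)) := (hf.2.2 _ _).2 (Or.inr rfl)

theorem IsModelOf.disjoint_of_isHoleOn (hA : A.IsModelOf G) (hf : G.IsHoleOn n f) {i j : ZMod n}
    (hij : i ≠ j) (h₁ : i ≠ j + 1) (h₂ : j ≠ i + 1) : Disjoint (A.arc (f i)) (A.arc (f j)) := by
  rw [Set.disjoint_iff_inter_eq_empty, ← Set.not_nonempty_iff_eq_empty]
  intro h
  rcases hA.eq_or_adj h with h | h
  · exact hij (hf.2.1 h)
  · rcases (hf.2.2 _ _).1 h with h | h
    · exact h₁ h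
    · exact h₂ h

theorem _root_.SimpleGraph.IsHoleOn.natCast_ne_zero (hf : G.IsHoleOn n f) {k : ℕ} (h₀ : 0 < k)
    (hk : k < 4) : (k : ZMod n) ≠ 0 := by
  rw [Ne, ZMod.natCast_eq_zero_iff]
  intro h
  have := Nat.le_of_dvd h₀ h
  have := hf.1
  omega

theorem IsModelOf.disjoint_add_two (hA : A.IsModelOf G) (hf : G.IsHoleOn n f) (i : ZMod n) :
    Disjoint (A.arc (f i)) (A.arc (f (i + 2))) := by
  have h1 := hf.natCast_ne_zero (k := 1) (by norm_num) (by norm_num)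
  have h2 := hf.natCast_ne_zero (k := 2) (by norm_num) (by norm_num)
  have h3 := hf.natCast_ne_zero (k := 3) (by norm_num) (by norm_num)
  push_cast at h1 h2 h3
  refine hA.disjoint_of_isHoleOn hf (fun h ↦ h2 ?_) (fun h ↦ h3 ?_) (fun h ↦ h1 ?_)
  · linear_combination -h
  · linear_combination -h
  · linear_combination h

theorem IsModelOf.hole_cover (hA : A.IsModelOf G) (hf : G.IsHoleOn n f) :
    ⋃ i, A.arc (f i) = Set.univ := by
  have := hf.neZero
  exact IsArcLike.cover_of_cycle A.L_pos (fun i ↦ A.isArcLike_arc (f i)) (hA.disjoint_add_two hf)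
    (fun i ↦ hA.inter_nonempty (Or.inr (hf.adj_succ i)))

theorem IsModelOf.hole_cover_minimal (hA : A.IsModelOf G) (hf : G.IsHoleOn n f) {T : Set V}
    (hT : T ⊂ Set.range f) : (⋃ v ∈ T, A.arc v) ≠ Set.univ := by
  intro hcov
  obtain ⟨hTs, hTn⟩ := Set.ssubset_def ▸ hT
  obtain ⟨v, ⟨i, rfl⟩, hi⟩ := Set.not_subset.1 hTn
  have h₁ : (A.arc (f i) ∩ A.arc (f (i - 1))).Nonempty := by
    have := hA.inter_nonempty (Or.inr (hf.adj_succ (i - 1)))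
    rwa [sub_add_cancel, Set.inter_comm] at this
  have h₂ := hA.inter_nonempty (Or.inr (hf.adj_succ i))
  have hsub : A.arc (f i) ⊆ A.arc (f (i - 1)) ∪ A.arc (f (i + 1)) := by
    intro z hz
    have hz' : z ∈ ⋃ v ∈ T, A.arc v := hcov ▸ Set.mem_univ z
    simp only [Set.mem_iUnion] at hz'
    obtain ⟨w, hw, hzw⟩ := hz'
    obtain ⟨j, rfl⟩ := hTs hw
    by_contra hcon
    rw [Set.mem_union, not_or] at hcon
    refine Set.disjoint_left.1 (hA.disjoint_of_isHoleOn hf (i := i) (j := j) ?_ ?_ ?_) hz hzw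
    · rintro rfl
      exact hi hw
    · rintro rfl
      rw [add_sub_cancel_right] at hcon
      exact hcon.1 hzw
    · rintro rfl
      exact hcon.2 hzw
  obtain ⟨z, -, hz, hz'⟩ := isPreconnected_closed_iff.1 (A.isPreconnected_arc (f i)) _ _
    (A.isClosed_arc _) (A.isClosed_arc _) hsub h₁ h₂
  have := hA.disjoint_add_two hf (i - 1)
  rw [show i - 1 + 2 = i + 1 by ring] at this
  exact Set.disjoint_left.1 this hz hz'

/-- In a proper Helly model, no arc meets all arcs of a hole. -/
theorem IsModelOf.not_forall_hole_inter (hA : A.IsModelOf G) (hP : A.Proper) (hH : A.Helly)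
    (hf : G.IsHoleOn n f) (u : V) (hu : ∀ i, (A.arc u ∩ A.arc (f i)).Nonempty) : False := by
  have := hf.neZero
  have hnot : ∀ i, ¬ A.arc (f (i + 2)) ⊆ A.arc u := by
    intro i h
    have h' : A.arc (f (i + 2)) = A.arc u := by
      by_contra hne
      exact hP _ _ (h.ssubset_of_ne hne)
    obtain ⟨z, hz, hz'⟩ := hu i
    exact Set.disjoint_left.1 (hA.disjoint_add_two hf i) hz' (h' ▸ hz)
  obtain ⟨p, hp⟩ := A.arc_nonempty u
  obtain ⟨g, -, hg⟩ := Set.not_subset.1 (hnot 0)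
  obtain ⟨i, x, rfl, y, rfl, -, -, hcov⟩ := IsArcLike.exists_cover_of_cycle (S := {u}) (F := A.arc)
    A.L_pos (fun i ↦ A.isArcLike_arc (f i)) (hA.disjoint_add_two hf)
    (fun x _ ↦ A.isArcLike_arc x) (p := p) (g := g) (by simpa using hp) (by simpa using hg)
    (fun i ↦ by
      obtain ⟨z, h1, h2, h3⟩ := hH.exists_mem_triple (hu i) (hu (i + 1))
        (hA.inter_nonempty (Or.inr (hf.adj_succ i)))
      exact ⟨u, rfl, z, ⟨h2, h3⟩, h1⟩)
  rw [Set.union_self] at hcov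
  refine hnot i fun z hz ↦ ?_
  have hz' := hcov.ge (Set.mem_univ z)
  exact hz'.resolve_right fun h ↦ Set.disjoint_left.1 (hA.disjoint_add_two hf i) h hz

/-- In a proper Helly model of a graph with a hole, no two arcs cover the circle. -/
theorem IsModelOf.union_ne_univ (hA : A.IsModelOf G) (hP : A.Proper) (hH : A.Helly)
    (hf : G.IsHoleOn n f) (u v : V) : A.arc u ∪ A.arc v ≠ Set.univ := by
  intro huv
  refine hA.not_forall_hole_inter hP hH hf u fun i ↦ ?_
  by_contra hi
  have hsub : A.arc (f i) ⊆ A.arc v := fun z hz ↦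
    (huv.ge (Set.mem_univ z)).resolve_left fun h ↦ hi ⟨z, h, hz⟩
  have heq : A.arc (f i) = A.arc v := by
    by_contra hne
    exact hP _ _ (hsub.ssubset_of_ne hne)
  exact hi (heq ▸ A.inter_nonempty_of_union_eq_univ huv)

/-- In a proper Helly model of a graph with a hole, no finite family of pairwise intersecting
arcs covers the circle. -/
theorem IsModelOf.exists_notMem_of_inter [Finite V] (hA : A.IsModelOf G) (hP : A.Proper)
    (hH : A.Helly) (hf : G.IsHoleOn n f) {S : Set V}
    (hS : ∀ u ∈ S, ∀ v ∈ S, (A.arc u ∩ A.arc v).Nonempty) : ∃ g, ∀ x ∈ S, g ∉ A.arc x := by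
  obtain ⟨p, hp⟩ := hH S hS
  simp only [Set.mem_iInter] at hp
  exact IsArcLike.exists_notMem_of_pairwise A.L_pos S.toFinite (fun x _ ↦ A.isArcLike_arc x) hp
    (fun x _ y _ ↦ hA.union_ne_univ hP hH hf x y)

/-- A clique of a non-chordal proper Helly circular-arc graph never covers the circle, whatever
the model. -/
theorem IsModelOf.clique_cover_ne_univ [Finite V] (hG : G.IsPHCA) (hA : A.IsModelOf G)
    (hf : G.IsHoleOn n f) {S : Set V} (hS : ∀ u ∈ S, ∀ v ∈ S, u = v ∨ G.Adj u v) :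
    (⋃ v ∈ S, A.arc v) ≠ Set.univ := by
  intro hcov
  obtain ⟨B, hB, hP, hH⟩ := hG
  have := hf.neZero
  have hSB : ∀ u ∈ S, ∀ v ∈ S, (B.arc u ∩ B.arc v).Nonempty :=
    fun u hu v hv ↦ hB.inter_nonempty (hS u hu v hv)
  obtain ⟨g, hg⟩ := hB.exists_notMem_of_inter hP hH hf hSB
  obtain ⟨p, hp⟩ := hH S hSB
  simp only [Set.mem_iInter] at hp
  obtain ⟨i, x, hx, y, hy, hxi, hyi, huniv⟩ := IsArcLike.exists_cover_of_cycle (F := B.arc)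
    B.L_pos (fun i ↦ B.isArcLike_arc (f i)) (hB.disjoint_add_two hf)
    (fun x _ ↦ B.isArcLike_arc x) hp hg (fun i ↦ by
      obtain ⟨z, hz, hz'⟩ := hA.inter_nonempty (Or.inr (hf.adj_succ i))
      have hzS : z ∈ ⋃ v ∈ S, A.arc v := hcov ▸ Set.mem_univ z
      simp only [Set.mem_iUnion] at hzS
      obtain ⟨x, hx, hzx⟩ := hzS
      obtain ⟨q, h1, h2, h3⟩ := hH.exists_mem_triple
        (hB.inter_nonempty (hA.eq_or_adj ⟨z, hzx, hz⟩))
        (hB.inter_nonempty (hA.eq_or_adj ⟨z, hzx, hz'⟩))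
        (hB.inter_nonempty (Or.inr (hf.adj_succ i)))
      exact ⟨x, hx, q, ⟨h2, h3⟩, h1⟩)
  have hne := B.arc_nonempty
  have hxy := hSB x hx y hy
  obtain ⟨g', hg'⟩ := hB.exists_notMem_of_inter hP hH hf (S := {x, y, f i}) (by
    rintro x (rfl | rfl | rfl) y (rfl | rfl | rfl) <;>
      first
        | assumption
        | (rw [Set.inter_comm]; assumption)
        | (rw [Set.inter_self]; exact hne _))
  rcases huniv.ge (Set.mem_univ g') with (h | h) | h
  · exact hg' x (by simp) h
  · exact hg' y (by simp) h
  · exact hg' (f i) (by simp) h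

end Hole

/-- In a family of arcs covering the circle, two arcs with cyclically consecutive private points
intersect. -/
theorem inter_nonempty_of_consecutive {S : Set V} (hcov : (⋃ v ∈ S, A.arc v) = Set.univ) {v w : V}
    {a b : ℝ} (hab : a < b) (hav : (a : AddCircle A.L) ∈ A.arc v)
    (hbw : (b : AddCircle A.L) ∈ A.arc w)
    (h : ∀ k ∈ S, k ≠ v → k ≠ w → (a : AddCircle A.L) ∉ A.arc k ∧ (b : AddCircle A.L) ∉ A.arc k ∧
      ∃ d : ℝ, b < d ∧ d < a + A.L ∧ (d : AddCircle A.L) ∈ A.arc k) :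
    (A.arc v ∩ A.arc w).Nonempty := by
  have hsub : (fun x : ℝ ↦ (x : AddCircle A.L)) '' Set.Icc a b ⊆ A.arc v ∪ A.arc w := by
    rintro _ ⟨t, ⟨hat, htb⟩, rfl⟩
    have ht : (t : AddCircle A.L) ∈ ⋃ v ∈ S, A.arc v := hcov ▸ Set.mem_univ _
    simp only [Set.mem_iUnion] at ht
    obtain ⟨k, hk, htk⟩ := ht
    by_contra hcon
    rw [Set.mem_union, not_or] at hcon
    obtain ⟨hak, hbk, d, hbd, hda, hdk⟩ := h k hk (by rintro rfl; exact hcon.1 htk)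
      (by rintro rfl; exact hcon.2 htk)
    rcases hat.eq_or_lt with rfl | hat
    · exact hcon.1 hav
    rcases htb.eq_or_lt with rfl | htb
    · exact hcon.2 hbw
    have := A.isArcLike_arc k htb hbd hda (by linarith) htk hbk hdk
    rw [AddCircle.coe_add_period] at this
    exact hak this
  obtain ⟨z, -, hz⟩ := isPreconnected_closed_iff.1
    (isPreconnected_Icc.image _ (AddCircle.continuous_mk' A.L).continuousOn) _ _
    (A.isClosed_arc v) (A.isClosed_arc w) hsub
    ⟨a, ⟨a, ⟨le_rfl, hab.le⟩, rfl⟩, hav⟩ ⟨b, ⟨b, ⟨hab.le, le_rfl⟩, rfl⟩, hbw⟩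
  exact ⟨z, hz⟩

/-- The members of a minimal cover can be listed by increasing private points. -/
theorem exists_enumeration_of_minimal_cover [Finite V] {S : Set V}
    (hcov : (⋃ v ∈ S, A.arc v) = Set.univ)
    (hmin : ∀ T : Set V, T ⊂ S → (⋃ v ∈ T, A.arc v) ≠ Set.univ) :
    ∃ (n : ℕ) (e : Fin n → V) (q : Fin n → ℝ), Set.range e = S ∧ StrictMono q ∧
      (∀ i, q i ∈ Set.Ico 0 A.L) ∧ ∀ i j, (q i : AddCircle A.L) ∈ A.arc (e j) ↔ i = j := by
  classical
  have hpriv : ∀ v ∈ S, ∃ t ∈ Set.Ico 0 A.L, (t : AddCircle A.L) ∈ A.arc v ∧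
      ∀ w ∈ S, w ≠ v → (t : AddCircle A.L) ∉ A.arc w := by
    intro v hv
    obtain ⟨z, hz⟩ := (Set.ne_univ_iff_exists_notMem _).1 (hmin (S \ {v})
      (Set.sdiff_singleton_ssubset.2 hv))
    obtain ⟨t, ht, rfl⟩ := exists_mem_Ico_coe_eq A.L_pos 0 z
    rw [zero_add] at ht
    have hz' : ∀ w ∈ S, w ≠ v → (t : AddCircle A.L) ∉ A.arc w := by
      intro w hw hwv htw
      exact hz (Set.mem_biUnion (show w ∈ S \ {v} from ⟨hw, hwv⟩) htw)
    refine ⟨t, ht, ?_, hz'⟩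
    have htS : (t : AddCircle A.L) ∈ ⋃ v ∈ S, A.arc v := hcov ▸ Set.mem_univ _
    simp only [Set.mem_iUnion] at htS
    obtain ⟨w, hw, htw⟩ := htS
    by_cases hwv : w = v
    · exact hwv ▸ htw
    · exact absurd htw (hz' w hw hwv)
  choose! q hq hqv hqw using hpriv
  have hinj : Set.InjOn q S := by
    intro v hv w hw hvw
    by_contra hne
    exact hqw v hv w hw (Ne.symm hne) (hvw ▸ hqv w hw)
  let T := S.toFinite.toFinset.image q
  let o := T.orderEmbOfFin rfl
  have ho : ∀ i, ∃ v ∈ S, q v = o i := by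
    intro i
    have := T.orderEmbOfFin_mem rfl i
    rw [Finset.mem_image] at this
    obtain ⟨v, hv, hvi⟩ := this
    exact ⟨v, by simpa using hv, hvi⟩
  choose e heS heq using ho
  have hmono : StrictMono fun i ↦ q (e i) := by
    simp only [heq]
    exact o.strictMono
  refine ⟨T.card, e, fun i ↦ q (e i), ?_, hmono, fun i ↦ hq _ (heS i), fun i j ↦ ⟨fun h ↦ ?_, ?_⟩⟩
  · apply Set.Subset.antisymm
    · rintro _ ⟨i, rfl⟩
      exact heS i
    · intro v hv
      have hvT : q v ∈ Set.range o := by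
        rw [Finset.range_orderEmbOfFin]
        exact Finset.mem_coe.2 (Finset.mem_image_of_mem q (by simpa using hv))
      obtain ⟨i, hi⟩ := hvT
      exact ⟨i, hinj (heS i) hv ((heq i).trans hi)⟩
  · by_contra hij
    refine hqw _ (heS i) _ (heS j) (fun hji ↦ hij ?_) h
    exact hmono.injective (congrArg q hji.symm)
  · rintro rfl
    exact hqv _ (heS i)

/-- In a cover listed by increasing private points, exactly the cyclically consecutive arcs
intersect. -/
theorem inter_nonempty_iff_of_enumeration {n : ℕ} {e : Fin n → V} {q : Fin n → ℝ}
    (hcov : (⋃ v ∈ Set.range e, A.arc v) = Set.univ) (hq : StrictMono q)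
    (hqL : ∀ i, q i ∈ Set.Ico 0 A.L) (hqe : ∀ i j, (q i : AddCircle A.L) ∈ A.arc (e j) ↔ i = j)
    {i j : Fin n} (hij : i < j) :
    (A.arc (e i) ∩ A.arc (e j)).Nonempty ↔
      j.val = i.val + 1 ∨ (i.val = 0 ∧ j.val + 1 = n) := by
  have hqL' : ∀ i k, q i < q k + A.L := fun i k ↦ by linarith [(hqL i).2, (hqL k).1]
  constructor
  · intro h
    by_contra hcon
    rw [not_or] at hcon
    have hij' : i.val < j.val := hij
    have hj := j.isLt
    have hdisj : Disjoint (A.arc (e i)) (A.arc (e j)) := by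
      let c : Fin n := ⟨i.val + 1, by omega⟩
      have hic : i < c := Fin.lt_def.2 (by simp [c])
      have hcj : c < j := Fin.lt_def.2 (by simp only [c]; omega)
      have hout : ∃ (k : Fin n) (d : ℝ), k ≠ i ∧ k ≠ j ∧ q j < d ∧ d < q i + A.L ∧
          (d : AddCircle A.L) = q k := by
        by_cases hi : i.val = 0
        · have hjn : j.val + 1 < n := by
            have : ¬ j.val + 1 = n := fun h ↦ hcon.2 ⟨hi, h⟩
            omega
          have hjk : j < ⟨j.val + 1, hjn⟩ := Fin.lt_def.2 (by simp)
          exact ⟨_, q ⟨j.val + 1, hjn⟩, (hij.trans hjk).ne', hjk.ne', hq hjk, hqL' _ _, rfl⟩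
        · have hki : (⟨0, by omega⟩ : Fin n) < i := Fin.lt_def.2 (by simp only; omega)
          exact ⟨_, q ⟨0, by omega⟩ + A.L, hki.ne, (hki.trans hij).ne, hqL' _ _,
            by linarith [hq hki], AddCircle.coe_add_period _ _⟩
      obtain ⟨k, d, hki, hkj, hjd, hdi, hdk⟩ := hout
      refine (A.isArcLike_arc (e i)).disjoint_of_separated A.L_pos (A.isArcLike_arc (e j))
        (hq hic) (hq hcj) hjd hdi ?_ ?_ ?_ ?_ ?_ ?_ ?_ ?_
      · exact (hqe _ _).2 rfl
      · exact fun h ↦ hij.ne ((hqe _ _).1 h)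
      · exact fun h ↦ hij.ne' ((hqe _ _).1 h)
      · exact (hqe _ _).2 rfl
      · exact fun h ↦ hic.ne' ((hqe _ _).1 h)
      · exact fun h ↦ hcj.ne ((hqe _ _).1 h)
      · exact fun h ↦ hki ((hqe _ _).1 (hdk ▸ h))
      · exact fun h ↦ hkj ((hqe _ _).1 (hdk ▸ h))
    obtain ⟨z, hz, hz'⟩ := h
    exact Set.disjoint_left.1 hdisj hz hz'
  · rintro (h | ⟨hi, hj⟩)
    · refine inter_nonempty_of_consecutive hcov (hq hij) ((hqe _ _).2 rfl) ((hqe _ _).2 rfl) ?_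
      rintro _ ⟨k, rfl⟩ hki hkj
      have hki' : k ≠ i := fun h ↦ hki (h ▸ rfl)
      have hkj' : k ≠ j := fun h ↦ hkj (h ▸ rfl)
      refine ⟨fun h ↦ hki' ((hqe _ _).1 h).symm, fun h ↦ hkj' ((hqe _ _).1 h).symm, ?_⟩
      rcases lt_or_gt_of_ne hkj' with hlt | hgt
      · have hki'' : k < i := by
          have := Fin.val_ne_of_ne hki'
          rw [Fin.lt_def] at hlt ⊢
          omega
        refine ⟨q k + A.L, hqL' _ _, by linarith [hq hki''], ?_⟩
        rw [AddCircle.coe_add_period]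
        exact (hqe _ _).2 rfl
      · exact ⟨q k, hq hgt, hqL' _ _, (hqe _ _).2 rfl⟩
    · rw [Set.inter_comm]
      refine inter_nonempty_of_consecutive hcov (hqL' j i) ((hqe _ _).2 rfl)
        (by rw [AddCircle.coe_add_period]; exact (hqe _ _).2 rfl) ?_
      rintro _ ⟨k, rfl⟩ hkj hki
      have hki' : k ≠ i := fun h ↦ hki (h ▸ rfl)
      have hkj' : k ≠ j := fun h ↦ hkj (h ▸ rfl)
      have h₁ : i < k := by
        have := Fin.val_ne_of_ne hki'
        rw [Fin.lt_def]
        omega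
      have h₂ : k < j := by
        have := Fin.val_ne_of_ne hkj'
        have := k.isLt
        rw [Fin.lt_def]
        omega
      rw [AddCircle.coe_add_period]
      refine ⟨fun h ↦ hkj' ((hqe _ _).1 h).symm, fun h ↦ hki' ((hqe _ _).1 h).symm,
        q k + A.L, by linarith [hq h₁], by linarith [hq h₂], ?_⟩
      rw [AddCircle.coe_add_period]
      exact (hqe _ _).2 rfl

theorem IsModelOf.exists_isHoleOn_of_minimal_cover [Finite V] (hG : G.IsPHCA)
    (hnc : ¬ G.Chordal) (hA : A.IsModelOf G) {S : Set V}
    (hcov : (⋃ v ∈ S, A.arc v) = Set.univ)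
    (hmin : ∀ T : Set V, T ⊂ S → (⋃ v ∈ T, A.arc v) ≠ Set.univ) :
    ∃ (n : ℕ) (f : ZMod n → V), G.IsHoleOn n f ∧ Set.range f = S := by
  obtain ⟨m, f, hf⟩ := not_not.1 hnc
  obtain ⟨n, e, q, rfl, hq, hqL, hqe⟩ := exists_enumeration_of_minimal_cover hcov hmin
  have hinj : Function.Injective e := by
    intro i j hij
    exact (hqe i j).1 (hij ▸ (hqe i i).2 rfl)
  have hlt : ∀ i j : Fin n, i < j → (G.Adj (e i) (e j) ↔
      j.val = i.val + 1 ∨ (i.val = 0 ∧ j.val + 1 = n)) := fun i j hij ↦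
    (hA.2 _ _ (hinj.ne hij.ne)).trans (inter_nonempty_iff_of_enumeration hcov hq hqL hqe hij)
  have hn : 4 ≤ n := by
    by_contra hn
    refine hA.clique_cover_ne_univ hG hf (S := Set.range e) ?_ hcov
    rintro _ ⟨i, rfl⟩ _ ⟨j, rfl⟩
    have hi := i.isLt
    have hj := j.isLt
    rcases lt_trichotomy i j with h | rfl | h
    · rw [hlt i j h]
      rw [Fin.lt_def] at h
      omega
    · exact Or.inl rfl
    · rw [G.adj_comm, hlt j i h]
      rw [Fin.lt_def] at h
      omega
  obtain ⟨k, rfl⟩ : ∃ k, n = k + 1 := ⟨n - 1, by omega⟩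
  have hsucc : ∀ i j : Fin (k + 1), i = j + 1 ↔
      i.val = j.val + 1 ∨ (i.val = 0 ∧ j.val = k) := by
    intro i j
    have hi := i.isLt
    have hj := j.isLt
    rw [Fin.ext_iff, Fin.val_add_one]
    simp only [Fin.ext_iff, Fin.val_last]
    split_ifs with h <;> omega
  refine ⟨k + 1, e, ⟨hn, hinj, fun (i j : Fin (k + 1)) ↦ ?_⟩, rfl⟩
  change _ ↔ (i = j + 1 ∨ j = i + 1)
  rw [hsucc, hsucc]
  rcases lt_trichotomy i j with h | rfl | h
  · rw [hlt i j h]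
    rw [Fin.lt_def] at h
    omega
  · simp only [SimpleGraph.irrefl, false_iff]
    omega
  · rw [G.adj_comm, hlt j i h]
    rw [Fin.lt_def] at h
    omega

end PreArcModel

/-- In an arc model of a non-chordal proper Helly circular-arc graph,
a set of vertices minimally covers the circle iff it induces a hole. -/
theorem stmt5 {V : Type*} [Fintype V] (G : SimpleGraph V) (hphca : G.IsPHCA)
    (hnc : ¬ G.Chordal) (A : PreArcModel V) (hA : A.IsModelOf G) (S : Set V) :
    ((⋃ v ∈ S, A.arc v) = Set.univ ∧
      ∀ T : Set V, T ⊂ S → (⋃ v ∈ T, A.arc v) ≠ Set.univ) ↔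
    ∃ (n : ℕ) (f : ZMod n → V), G.IsHoleOn n f ∧ Set.range f = S := by
  constructor
  · rintro ⟨hcov, hmin⟩
    exact hA.exists_isHoleOn_of_minimal_cover hphca hnc hcov hmin
  · rintro ⟨n, f, hf, rfl⟩
    refine ⟨?_, fun T hT ↦ hA.hole_cover_minimal hf hT⟩
    rw [Set.biUnion_range]
    exact hA.hole_cover hf
end

section
/- Let A be a proper and Helly arc model for a non-chordal graph G. A set V_- of vertices of G is a hole cover of G (i.e., G − V_- is chordal) if and only if there is a point α of the circle such that K_A(α) ⊆ V_-. -/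
namespace PreArcModel

variable {V : Type*}

/-- The left endpoint of a lift `(v, k)` of the arc of `v` to the real line. -/
def left (A : PreArcModel V) (x : V × ℤ) : ℝ := A.src x.1 + x.2 * A.L

/-- The right endpoint of a lift `(v, k)` of the arc of `v` to the real line. -/
def right (A : PreArcModel V) (x : V × ℤ) : ℝ := A.src x.1 + A.len x.1 + x.2 * A.L

/-- Translation of a lift by `m` full turns. -/
def shift (x : V × ℤ) (m : ℤ) : V × ℤ := (x.1, x.2 + m)

theorem left_shift (A : PreArcModel V) (x : V × ℤ) (m : ℤ) :
    A.left (shift x m) = A.left x + m * A.L := by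
  simp only [left, shift]; push_cast; ring

theorem right_shift (A : PreArcModel V) (x : V × ℤ) (m : ℤ) :
    A.right (shift x m) = A.right x + m * A.L := by
  simp only [right, shift]; push_cast; ring

theorem shift_shift (x : V × ℤ) (m k : ℤ) : shift (shift x m) k = shift x (m + k) := by
  simp only [shift, add_assoc]

theorem left_lt_right (A : PreArcModel V) (x : V × ℤ) : A.left x < A.right x := by
  simp only [left, right]; linarith [A.len_pos x.1]

theorem right_lt_left_add (A : PreArcModel V) (x : V × ℤ) : A.right x < A.left x + A.L := by
  simp only [left, right]; linarith [A.len_lt x.1]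

theorem int_lt_of_mul_lt (A : PreArcModel V) {m k : ℤ} (h : m * A.L < k * A.L) : m < k := by
  have := lt_of_mul_lt_mul_right h A.L_pos.le
  exact_mod_cast this

theorem mul_le_mul_L (A : PreArcModel V) {m k : ℤ} (h : m ≤ k) : (m * A.L : ℝ) ≤ k * A.L :=
  mul_le_mul_of_nonneg_right (by exact_mod_cast h) A.L_pos.le

theorem coe_mem_arc (A : PreArcModel V) (x : V × ℤ) (t : ℝ) :
    (t : AddCircle A.L) ∈ A.arc x.1 ↔
      ∃ m : ℤ, A.left x + m * A.L ≤ t ∧ t ≤ A.right x + m * A.L := by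
  constructor
  · rintro ⟨y, ⟨h1, h2⟩, h⟩
    have h' : ((t - y : ℝ) : AddCircle A.L) = 0 := by
      rw [AddCircle.coe_sub, sub_eq_zero]; exact h.symm
    obtain ⟨m, hm⟩ := (AddCircle.coe_eq_zero_iff A.L).mp h'
    rw [zsmul_eq_mul] at hm
    refine ⟨m - x.2, ?_, ?_⟩ <;> simp only [left, right] <;> push_cast <;> linarith
  · rintro ⟨m, h1, h2⟩
    refine ⟨t - (x.2 + m : ℤ) * A.L, ⟨?_, ?_⟩, ?_⟩
    · simp only [left] at h1; push_cast; linarith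
    · simp only [right] at h2; push_cast; linarith
    · have h' : (((x.2 + m : ℤ) * A.L : ℝ) : AddCircle A.L) = 0 :=
        (AddCircle.coe_eq_zero_iff A.L).mpr ⟨x.2 + m, by rw [zsmul_eq_mul]⟩
      simp only [AddCircle.coe_sub, h', sub_zero]

theorem coe_mem_arc_of_mem (A : PreArcModel V) (x : V × ℤ) {t : ℝ} (h1 : A.left x ≤ t)
    (h2 : t ≤ A.right x) : (t : AddCircle A.L) ∈ A.arc x.1 :=
  (A.coe_mem_arc x t).mpr ⟨0, by simpa using h1, by simpa using h2⟩

theorem arc_inter_nonempty_iff (A : PreArcModel V) (x y : V × ℤ) :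
    (A.arc x.1 ∩ A.arc y.1).Nonempty ↔
      ∃ m : ℤ, A.left x ≤ A.right (shift y m) ∧ A.left (shift y m) ≤ A.right x := by
  constructor
  · rintro ⟨a, ha, hb⟩
    obtain ⟨t, rfl⟩ := QuotientAddGroup.mk_surjective a
    obtain ⟨m, h1, h2⟩ := (A.coe_mem_arc x t).mp ha
    obtain ⟨k, h3, h4⟩ := (A.coe_mem_arc y t).mp hb
    refine ⟨k - m, ?_, ?_⟩ <;> simp only [left_shift, right_shift] <;> push_cast <;> linarith
  · rintro ⟨m, h1, h2⟩
    refine ⟨(max (A.left x) (A.left (shift y m)) : ℝ),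
      A.coe_mem_arc_of_mem x (le_max_left _ _) (max_le (A.left_lt_right x).le h2),
      A.coe_mem_arc_of_mem (shift y m) (le_max_right _ _)
        (max_le h1 (A.left_lt_right _).le)⟩

theorem exists_lift_Ioc (A : PreArcModel V) (v : V) (a : ℝ) :
    ∃ k : ℤ, a < A.left (v, k) ∧ A.left (v, k) ≤ a + A.L := by
  obtain ⟨k, ⟨h1, h2⟩, -⟩ := existsUnique_add_zsmul_mem_Ioc A.L_pos (A.src v) a
  rw [zsmul_eq_mul] at h1 h2
  exact ⟨k, h1, h2⟩

theorem exists_lift_Ico (A : PreArcModel V) (v : V) (a : ℝ) :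
    ∃ k : ℤ, a ≤ A.left (v, k) ∧ A.left (v, k) < a + A.L := by
  obtain ⟨k, ⟨h1, h2⟩, -⟩ := existsUnique_add_zsmul_mem_Ico A.L_pos (A.src v) a
  rw [zsmul_eq_mul] at h1 h2
  exact ⟨k, h1, h2⟩

theorem Proper.eq_of_nested {A : PreArcModel V} (hA : A.Proper) {x y : V × ℤ}
    (h1 : A.left x ≤ A.left y) (h2 : A.right y ≤ A.right x) :
    A.left x = A.left y ∧ A.right x = A.right y := by
  have hsub : A.arc y.1 ⊆ A.arc x.1 := by
    intro a ha
    obtain ⟨t, rfl⟩ := QuotientAddGroup.mk_surjective a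
    obtain ⟨m, h3, h4⟩ := (A.coe_mem_arc y t).mp ha
    exact (A.coe_mem_arc x t).mpr ⟨m, by linarith, by linarith⟩
  have hsup : A.arc x.1 ⊆ A.arc y.1 := by
    by_contra h
    exact hA _ _ ⟨hsub, h⟩
  have hL := A.L_pos
  have hx := A.right_lt_left_add x
  have hx' := A.left_lt_right x
  constructor
  · obtain ⟨m, h3, h4⟩ := (A.coe_mem_arc y _).mp
      (hsup (A.coe_mem_arc_of_mem x le_rfl hx'.le))
    rcases le_or_gt 0 m with hm | hm
    · have := A.mul_le_mul_L hm
      simp at this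
      linarith
    · have := A.mul_le_mul_L (show m ≤ -1 by omega)
      simp at this
      linarith
  · obtain ⟨m, h3, h4⟩ := (A.coe_mem_arc y _).mp
      (hsup (A.coe_mem_arc_of_mem x hx'.le le_rfl))
    rcases le_or_gt m 0 with hm | hm
    · have := A.mul_le_mul_L hm
      simp at this
      linarith
    · have := A.mul_le_mul_L (show 1 ≤ m by omega)
      simp at this
      linarith

theorem Proper.right_le {A : PreArcModel V} (hA : A.Proper) {x y : V × ℤ}
    (h : A.left x ≤ A.left y) : A.right x ≤ A.right y := by
  by_contra! h'
  exact h'.ne' (hA.eq_of_nested h h'.le).2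

theorem Proper.left_lt {A : PreArcModel V} (hA : A.Proper) {x y : V × ℤ}
    (h : A.right x < A.right y) : A.left x < A.left y := by
  by_contra! h'
  exact absurd (hA.right_le h') (not_le.mpr h)

end PreArcModel

/-- Among the vertices of a hole, two at distance two are never adjacent. -/
theorem SimpleGraph.IsHoleOn.not_adj_add_two {V : Type*} {G : SimpleGraph V} {n : ℕ}
    {f : ZMod n → V} (h : G.IsHoleOn n f) (i : ZMod n) :
    f i ≠ f (i + 2) ∧ ¬ G.Adj (f i) (f (i + 2)) := by
  obtain ⟨hn, hinj, hadj⟩ := h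
  have hk : ∀ k : ℕ, 0 < k → k < n → (k : ZMod n) ≠ 0 := fun k h0 h1 h2 =>
    absurd (Nat.le_of_dvd h0 ((ZMod.natCast_eq_zero_iff _ _).mp h2)) (by omega)
  have h1 := hk 1 (by omega) (by omega)
  have h2 := hk 2 (by omega) (by omega)
  have h3 := hk 3 (by omega) (by omega)
  push_cast at h1 h2 h3
  refine ⟨fun h => h2 (by simpa using hinj h), fun h => ?_⟩
  rcases (hadj _ _).mp h with h | h
  · exact h3 (by linear_combination -h)
  · exact h1 (by linear_combination h)

/-- A graph with a hole is not covered by two cliques `C c` for which both ends of every edge lie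
in a common set `M c` of vertices adjacent to all of `C c`. -/
theorem SimpleGraph.IsHoleOn.false_of_cliques {V : Type*} {G : SimpleGraph V} {n : ℕ}
    {f : ZMod n → V} (h : G.IsHoleOn n f) (C M : Bool → Set V)
    (hC : ∀ v, ∃ c, v ∈ C c) (hadj : ∀ c u v, u ∈ C c → v ∈ M c → u ≠ v → G.Adj u v)
    (hCM : ∀ c, C c ⊆ M c)
    (hM : ∀ u v, G.Adj u v → ∃ c, u ∈ M c ∧ v ∈ M c) : False := by
  obtain ⟨hn, hinj, hf⟩ := id h
  have hk : ∀ k : ℕ, 0 < k → k < n → (k : ZMod n) ≠ 0 := fun k h0 h1 h2 =>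
    absurd (Nat.le_of_dvd h0 ((ZMod.natCast_eq_zero_iff _ _).mp h2)) (by omega)
  have h1 := hk 1 (by omega) (by omega)
  have h2 := hk 2 (by omega) (by omega)
  have h3 := hk 3 (by omega) (by omega)
  push_cast at h1 h2 h3
  have key : ∀ i, ∃ c, ∀ j, f j ∈ C c → j = i ∨ j = i + 1 := by
    intro i
    obtain ⟨c, hc1, hc2⟩ := hM (f i) (f (i + 1)) ((hf _ _).mpr (Or.inr rfl))
    refine ⟨c, fun j hj => ?_⟩
    by_contra! hne
    have e1 := (hf _ _).mp (hadj c _ _ hj hc1 (fun e => hne.1 (hinj e)))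
    have e2 := (hf _ _).mp (hadj c _ _ hj hc2 (fun e => hne.2 (hinj e)))
    rcases e1 with e1 | e1
    · exact hne.2 e1
    · rcases e2 with e2 | e2
      · exact h3 (by linear_combination -e2 - e1)
      · exact hne.1 (by linear_combination -e2)
  have two : ∀ c i, ¬ (f i ∉ C c ∧ f (i + 2) ∉ C c) := by
    rintro c i ⟨ha, hb⟩
    have hd : ∀ v, v ∉ C c → v ∈ C (!c) := by
      intro v hv
      obtain ⟨d, hd⟩ := hC v
      cases c <;> cases d <;> simp_all
    have := h.not_adj_add_two i
    exact this.2 (hadj _ _ _ (hd _ ha) (hCM _ (hd _ hb)) this.1)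
  obtain ⟨c0, H0⟩ := key 0
  obtain ⟨c1, H1⟩ := key 1
  obtain ⟨c2, H2⟩ := key 2
  have n02 : ¬ ((0 : ZMod n) = 2) := fun e => h2 e.symm
  by_cases e01 : c0 = c1
  · subst e01
    refine two c0 0 ⟨fun h => ?_, fun h => ?_⟩
    · rcases H1 _ h with e | e
      · exact h1 e.symm
      · exact h2 (by linear_combination -e)
    · rcases H0 _ h with e | e
      · exact h2 (by linear_combination e)
      · exact h1 (by linear_combination e)
  by_cases e02 : c0 = c2
  · subst e02
    refine two c0 0 ⟨fun h => ?_, fun h => ?_⟩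
    · rcases H2 _ h with e | e
      · exact h2 e.symm
      · exact h3 (by linear_combination -e)
    · rcases H0 _ h with e | e
      · exact h2 (by linear_combination e)
      · exact h1 (by linear_combination e)
  have e12 : c1 = c2 := by
    cases c0 <;> cases c1 <;> cases c2 <;> simp_all
  subst e12
  refine two c1 1 ⟨fun h => ?_, fun h => ?_⟩
  · rcases H2 _ h with e | e
    · exact h1 (by linear_combination -e)
    · exact h2 (by linear_combination -e)
  · rcases H1 _ h with e | e
    · exact h2 (by linear_combination e)
    · exact h1 (by linear_combination e)

namespace PreArcModel

variable {V : Type*}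

/-- Arcs that avoid a common point of the circle form a chordal (interval) graph. -/
theorem IsModelOf.chordal_induce_of_K_subset {G : SimpleGraph V} {A : PreArcModel V}
    (hm : A.IsModelOf G) {Vm : Set V} {α : AddCircle A.L} (hα : A.K α ⊆ Vm) :
    (G.induce {v | v ∉ Vm}).Chordal := by
  rintro ⟨n, f, hf⟩
  obtain ⟨a, rfl⟩ := QuotientAddGroup.mk_surjective α
  choose k hk1 hk2 using fun v => A.exists_lift_Ioc v a
  have hr : ∀ v, v ∉ Vm → A.right (v, k v) < a + A.L := by
    intro v hv
    by_contra! h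
    refine hv (hα ((A.coe_mem_arc (v, k v) a).mpr ⟨-1, ?_, ?_⟩))
    · push_cast; linarith [hk2 v]
    · push_cast; linarith
  have hadj : ∀ u v, u ∉ Vm → v ∉ Vm → u ≠ v → (G.Adj u v ↔
      A.left (u, k u) ≤ A.right (v, k v) ∧ A.left (v, k v) ≤ A.right (u, k u)) := by
    intro u v hu hv huv
    rw [hm.2 u v huv, A.arc_inter_nonempty_iff (u, k u) (v, k v)]
    constructor
    · rintro ⟨m, h1, h2⟩
      rw [left_shift] at h2
      rw [right_shift] at h1
      have m1 : (m : ℤ) < 1 := A.int_lt_of_mul_lt (by push_cast; linarith [hk1 v, hr u hu])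
      have m2 : -1 < m := A.int_lt_of_mul_lt (by push_cast; linarith [hk1 u, hr v hv])
      obtain rfl : m = 0 := by omega
      simp only [Int.cast_zero, zero_mul, add_zero] at h1 h2
      exact ⟨h1, h2⟩
    · rintro ⟨h1, h2⟩
      exact ⟨0, by simpa [shift] using h1, by simpa [shift] using h2⟩
  have hn := hf.1
  have : NeZero n := ⟨by omega⟩
  obtain ⟨i, hi⟩ := Finite.exists_min fun j => A.right ((f j : V), k (f j))
  have hnb : ∀ j, (i = j + 1 ∨ j = i + 1) →
      A.left ((f j : V), k (f j)) ≤ A.right ((f i : V), k (f i)) := by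
    intro j hj
    have e := (hf.2.2 i j).mpr hj
    exact ((hadj _ _ (f i).2 (f j).2 (fun h => e.ne (Subtype.ext h))).mp e).2
  have hne := hf.not_adj_add_two (i - 1)
  rw [show i - 1 + 2 = i + 1 by ring] at hne
  refine hne.2 ((hadj _ _ (f _).2 (f _).2 (fun h => hne.1 (Subtype.ext h))).mpr ⟨?_, ?_⟩)
  · exact (hnb _ (Or.inl (by ring))).trans (hi _)
  · exact (hnb _ (Or.inr rfl)).trans (hi _)

/-- In a proper and Helly model with two arcs covering the circle, the graph is chordal. -/
theorem IsModelOf.chordal_of_two_cover {G : SimpleGraph V} {A : PreArcModel V}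
    (hm : A.IsModelOf G) (hproper : A.Proper) (hhelly : A.Helly) {x y : V × ℤ}
    (h1 : A.left x < A.left y) (h2 : A.left y ≤ A.right x)
    (h3 : A.left y < A.left x + A.L) (h4 : A.left x + A.L ≤ A.right y) : G.Chordal := by
  rintro ⟨n, f, hf⟩
  let lo : Bool → ℝ := fun c => if c then A.left y else A.left x + A.L
  let hi : Bool → ℝ := fun c => if c then A.right x else A.right y
  have hlohi : ∀ c, lo c ≤ hi c := by
    intro c; cases c
    · exact h4
    · exact h2
  let C : Bool → Set V := fun c => {v | ∀ t, lo c ≤ t → t ≤ hi c → (t : AddCircle A.L) ∈ A.arc v}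
  let M : Bool → Set V := fun c => {v | ∃ t, lo c ≤ t ∧ t ≤ hi c ∧ (t : AddCircle A.L) ∈ A.arc v}
  have hC : ∀ v, ∃ c, v ∈ C c := by
    intro v
    obtain ⟨k, hk1, hk2⟩ := A.exists_lift_Ico v (A.left x)
    rcases le_or_gt (A.left (v, k)) (A.left y) with h | h
    · exact ⟨true, fun t ht1 ht2 => A.coe_mem_arc_of_mem (v, k) (h.trans ht1)
        (ht2.trans (hproper.right_le hk1))⟩
    · exact ⟨false, fun t ht1 ht2 => A.coe_mem_arc_of_mem (v, k) (hk2.le.trans ht1)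
        (ht2.trans (hproper.right_le h.le))⟩
  have hCM : ∀ c, C c ⊆ M c := fun c v hv =>
    ⟨lo c, le_rfl, hlohi c, hv _ le_rfl (hlohi c)⟩
  have hx : ∀ c, x.1 ∈ C c := by
    intro c t ht1 ht2
    refine (A.coe_mem_arc x t).mpr ?_
    cases c
    · refine ⟨1, ?_, ?_⟩
      · rw [Int.cast_one, one_mul]
        exact ht1
      have : A.right y ≤ A.right (shift x 1) :=
        hproper.right_le (by rw [left_shift]; push_cast; linarith)
      rw [right_shift] at this
      exact (show t ≤ A.right y from ht2).trans this
    · refine ⟨0, ?_, ?_⟩ <;> rw [Int.cast_zero, zero_mul, add_zero]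
      · exact h1.le.trans ht1
      · exact ht2
  have hy : ∀ c, y.1 ∈ C c := by
    intro c t ht1 ht2
    refine A.coe_mem_arc_of_mem y ?_ ?_
    · cases c
      · exact h3.le.trans ht1
      · exact ht1
    · cases c
      · exact ht2
      · exact (show t ≤ A.right x from ht2).trans (hproper.right_le h1.le)
  have meet : ∀ c u v, u ∈ C c → v ∈ M c → (A.arc u ∩ A.arc v).Nonempty := by
    rintro c u v hu ⟨t, ht1, ht2, ht⟩
    exact ⟨t, hu t ht1 ht2, ht⟩
  have meet_all : ∀ u, (∀ c, u ∈ C c) → ∀ v, (A.arc u ∩ A.arc v).Nonempty := by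
    intro u hu v
    obtain ⟨c, hc⟩ := hC v
    exact meet c u v (hu c) (hCM c hc)
  refine hf.false_of_cliques C M hC
    (fun c u v hu hv huv => (hm.2 u v huv).mpr (meet c u v hu hv)) hCM fun u v huv => ?_
  have hne := (hm.2 u v huv.ne).mp huv
  have self : ∀ w, (A.arc w ∩ A.arc w).Nonempty := fun w => by
    rw [Set.inter_self]
    exact ⟨_, A.coe_mem_arc_of_mem (w, 0) le_rfl (A.left_lt_right _).le⟩
  have sx := meet_all _ hx
  have sy := meet_all _ hy
  have hpair : ∀ a ∈ ({x.1, y.1, u, v} : Set V), ∀ b ∈ ({x.1, y.1, u, v} : Set V),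
      (A.arc a ∩ A.arc b).Nonempty := by
    rintro a (rfl | rfl | rfl | rfl) b hb
    · exact sx b
    · exact sy b
    · rcases hb with rfl | rfl | rfl | rfl
      · rw [Set.inter_comm]; exact sx _
      · rw [Set.inter_comm]; exact sy _
      · exact self _
      · exact hne
    · rcases hb with rfl | rfl | rfl | rfl
      · rw [Set.inter_comm]; exact sx _
      · rw [Set.inter_comm]; exact sy _
      · rw [Set.inter_comm]; exact hne
      · exact self _
  obtain ⟨p, hp⟩ := hhelly _ hpair
  simp only [Set.mem_iInter] at hp
  have px := hp x.1 (by simp)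
  have py := hp y.1 (by simp)
  have pu := hp u (by simp)
  have pv := hp v (by simp)
  obtain ⟨c, t, ht1, ht2, rfl⟩ : ∃ c t, lo c ≤ t ∧ t ≤ hi c ∧ (t : AddCircle A.L) = p := by
    obtain ⟨t, ⟨ht1, ht2⟩, rfl⟩ : p ∈ (fun t : ℝ => (t : AddCircle A.L)) ''
        Set.Icc (A.left y) (A.right y) := by
      obtain ⟨t, rfl⟩ := QuotientAddGroup.mk_surjective p
      obtain ⟨m, hm1, hm2⟩ := (A.coe_mem_arc y t).mp py
      have h' : ((m * A.L : ℝ) : AddCircle A.L) = 0 :=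
        (AddCircle.coe_eq_zero_iff A.L).mpr ⟨m, by rw [zsmul_eq_mul]⟩
      refine ⟨t - m * A.L, ⟨by linarith, by linarith⟩, ?_⟩
      simp only [AddCircle.coe_sub, h', sub_zero]
    obtain ⟨m, hm1, hm2⟩ := (A.coe_mem_arc x t).mp px
    rcases le_or_gt m 0 with hm | hm
    · have := A.mul_le_mul_L hm
      simp only [Int.cast_zero, zero_mul] at this
      exact ⟨true, t, ht1, show t ≤ A.right x by linarith, rfl⟩
    · have := A.mul_le_mul_L (show 1 ≤ m by omega)
      simp only [Int.cast_one, one_mul] at this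
      exact ⟨false, t, show A.left x + A.L ≤ t by linarith, ht2, rfl⟩
  exact ⟨c, ⟨t, ht1, ht2, pu⟩, ⟨t, ht1, ht2, pv⟩⟩

end PreArcModel

namespace PreArcModel

variable {V : Type*}

/-- A bi-infinite sequence of overlapping lifts of arcs outside `Vm`, moving to the right, that
is periodic: `n` steps amount to one full turn. -/
structure IsPeriodicChain (A : PreArcModel V) (Vm : Set V) (n : ℕ) (X : ℤ → V × ℤ) : Prop where
  pos : 0 < n
  notMem : ∀ i, (X i).1 ∉ Vm
  left_lt : ∀ i, A.left (X i) < A.left (X (i + 1))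
  left_le_right : ∀ i, A.left (X (i + 1)) ≤ A.right (X i)
  add_period : ∀ i, X (i + n) = shift (X i) 1

theorem exists_periodicChain_of_finite_chain {A : PreArcModel V} {Vm : Set V} {n : ℕ}
    (hn : 0 < n) (x : ℕ → V × ℤ) (hx : ∀ i < n, (x i).1 ∉ Vm)
    (hlt : ∀ i < n, A.left (x i) < A.left (x (i + 1)))
    (hle : ∀ i < n, A.left (x (i + 1)) ≤ A.right (x i))
    (hper : x n = shift (x 0) 1) : ∃ X, A.IsPeriodicChain Vm n X := by
  have hn' : (0 : ℤ) < n := by exact_mod_cast hn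
  let X : ℤ → V × ℤ := fun i => shift (x (i % n).toNat) (i / n)
  have hlt_n : ∀ (r : ℕ) (q : ℤ), r < n → X (r + n * q) = shift (x r) q := by
    intro r q hr
    have hr' : (r : ℤ) < n := by exact_mod_cast hr
    simp only [X]
    rw [Int.add_mul_emod_self_left, Int.add_mul_ediv_left _ _ hn'.ne',
      Int.emod_eq_of_lt (by positivity) hr', Int.ediv_eq_zero_of_lt (by positivity) hr']
    simp
  have hle_n : ∀ (r : ℕ) (q : ℤ), r ≤ n → X (r + n * q) = shift (x r) q := by
    intro r q hr
    rcases hr.lt_or_eq with h | rfl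
    · exact hlt_n r q h
    · have := hlt_n 0 (q + 1) hn
      rw [hper, shift_shift, add_comm 1 q, ← this]
      congr 1
      push_cast
      ring
  have hrep : ∀ i : ℤ, ∃ (r : ℕ) (q : ℤ), r < n ∧ i = r + n * q := by
    intro i
    refine ⟨(i % n).toNat, i / n, ?_, ?_⟩
    · have := Int.emod_lt_of_pos i hn'
      omega
    · rw [Int.toNat_of_nonneg (Int.emod_nonneg i hn'.ne'), Int.emod_add_mul_ediv]
  refine ⟨X, hn, ?_, ?_, ?_, ?_⟩ <;> intro i <;> obtain ⟨r, q, hr, rfl⟩ := hrep i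
  · rw [hlt_n r q hr]
    exact hx r hr
  · rw [hlt_n r q hr, show (r + n * q + 1 : ℤ) = (r + 1 : ℕ) + n * q by push_cast; ring,
      hle_n (r + 1) q hr, left_shift, left_shift]
    linarith [hlt r hr]
  · rw [hlt_n r q hr, show (r + n * q + 1 : ℤ) = (r + 1 : ℕ) + n * q by push_cast; ring,
      hle_n (r + 1) q hr, left_shift, right_shift]
    linarith [hle r hr]
  · rw [hlt_n r q hr, show (r + n * q + n : ℤ) = r + n * (q + 1) by ring,
      hlt_n r _ hr, shift_shift]

/-- If the arcs outside `Vm` cover the circle, every lift overlaps a lift further right. -/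
theorem Proper.exists_next [Finite V] {A : PreArcModel V} (hA : A.Proper) {Vm : Set V}
    (hcov : ∀ α : AddCircle A.L, ∃ v ∉ Vm, α ∈ A.arc v) (x : V × ℤ) :
    ∃ y : V × ℤ, y.1 ∉ Vm ∧ A.left x < A.left y ∧ A.left y ≤ A.right x ∧
      A.right x < A.right y := by
  choose k hk1 hk2 using fun v => A.exists_lift_Ioc v (A.right x)
  have : Nonempty V := ⟨x.1⟩
  obtain ⟨w, hw⟩ := Finite.exists_min fun v => A.left (v, k v)
  have hmid : A.right x < (A.right x + A.left (w, k w)) / 2 := by linarith [hk1 w]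
  have hmid' : (A.right x + A.left (w, k w)) / 2 < A.left (w, k w) := by linarith [hk1 w]
  obtain ⟨v, hv, hvt⟩ := hcov (((A.right x + A.left (w, k w)) / 2 : ℝ) : AddCircle A.L)
  obtain ⟨m, h1, h2⟩ := (A.coe_mem_arc (v, k v) _).mp hvt
  have hr : A.right x < A.right (shift (v, k v) m) := by
    rw [right_shift]; linarith
  refine ⟨shift (v, k v) m, hv, hA.left_lt hr, ?_, hr⟩
  have hm : m < 0 := A.int_lt_of_mul_lt (by push_cast; linarith [hw v])
  have := A.mul_le_mul_L (show m ≤ -1 by omega)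
  push_cast at this
  rw [left_shift]
  linarith [hk2 v]

theorem Proper.exists_periodicChain [Finite V] {A : PreArcModel V} (hA : A.Proper) {Vm : Set V}
    (hcov : ∀ α : AddCircle A.L, ∃ v ∉ Vm, α ∈ A.arc v) :
    ∃ n X, A.IsPeriodicChain Vm n X := by
  choose next hnext using fun x => hA.exists_next hcov x
  obtain ⟨v₀, hv₀, -⟩ := hcov 0
  let x : ℕ → V × ℤ := fun i => next^[i] (v₀, 0)
  have hsucc : ∀ i, x (i + 1) = next (x i) := fun i => Function.iterate_succ_apply' _ _ _
  have hx : ∀ i, (x i).1 ∉ Vm := by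
    intro i
    cases i with
    | zero => exact hv₀
    | succ i => rw [hsucc]; exact (hnext _).1
  have hlt : ∀ i, A.left (x i) < A.left (x (i + 1)) := fun i => by
    rw [hsucc]; exact (hnext _).2.1
  have hle : ∀ i, A.left (x (i + 1)) ≤ A.right (x i) := fun i => by
    rw [hsucc]; exact (hnext _).2.2.1
  have hmono : StrictMono fun i => A.left (x i) := strictMono_nat_of_lt_succ hlt
  have hex : ∃ m, A.left (x 0) + A.L ≤ A.right (x m) := by
    by_contra! hno
    refine not_injective_infinite_finite (fun i => (x i).1) fun i j hij => ?_
    have hbd : ∀ i j, A.left (x i) < A.left (x j) + A.L := fun i j => by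
      have h1 : A.left (x 0) ≤ A.left (x j) := hmono.monotone (Nat.zero_le j)
      linarith [hno i, A.left_lt_right (x i)]
    have hij' : (x i).1 = (x j).1 := hij
    have e1 := hbd i j
    have e2 := hbd j i
    apply hmono.injective
    simp only [left, hij'] at e1 e2 ⊢
    have l1 : (x i).2 < (x j).2 + 1 := A.int_lt_of_mul_lt (by push_cast; linarith)
    have l2 : (x j).2 < (x i).2 + 1 := A.int_lt_of_mul_lt (by push_cast; linarith)
    rw [show (x i).2 = (x j).2 by omega]
  classical
  have hm := Nat.find_spec hex
  have hmin := fun i => Nat.find_min hex (m := i)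
  generalize Nat.find hex = m at hm hmin
  have hm0 : A.left (x m) < A.left (x 0) + A.L := by
    cases m with
    | zero => linarith [A.L_pos]
    | succ k => exact (hle k).trans_lt (not_le.mp (hmin k (by omega)))
  refine ⟨m + 1, exists_periodicChain_of_finite_chain (Nat.succ_pos m)
    (fun i => if i ≤ m then x i else shift (x 0) 1) ?_ ?_ ?_ (by simp)⟩
  · intro i hi
    simpa [show i ≤ m by omega] using hx i
  · intro i hi
    by_cases h : i + 1 ≤ m
    · simpa [h, show i ≤ m by omega] using hlt i
    · obtain rfl : i = m := by omega
      simpa [left_shift] using hm0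
  · intro i hi
    by_cases h : i + 1 ≤ m
    · simpa [h, show i ≤ m by omega] using hle i
    · obtain rfl : i = m := by omega
      simpa [left_shift] using hm

namespace IsPeriodicChain

variable {A : PreArcModel V} {Vm : Set V} {n : ℕ} {X : ℤ → V × ℤ}

theorem strictMono (h : A.IsPeriodicChain Vm n X) : StrictMono fun i => A.left (X i) :=
  strictMono_int_of_lt_succ h.left_lt

theorem add_mul_period (h : A.IsPeriodicChain Vm n X) (i k : ℤ) :
    X (i + k * n) = shift (X i) k := by
  induction k using Int.induction_on with
  | zero => simp [shift]
  | succ k ih =>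
    rw [show i + ((k : ℤ) + 1) * n = i + k * n + n by ring, h.add_period, ih, shift_shift]
  | pred k ih =>
    have e := h.add_period (i + (-(k : ℤ) - 1) * n)
    rw [show i + (-(k : ℤ) - 1) * n + n = i + -(k : ℤ) * n by ring, ih] at e
    simp only [shift, Prod.mk.injEq] at e ⊢
    ext
    · exact e.1.symm
    · show (X (i + (-(k : ℤ) - 1) * n)).2 = _
      linarith [e.2]

theorem fst_eq_iff (h : A.IsPeriodicChain Vm n X) (i j : ℤ) :
    (X i).1 = (X j).1 ↔ (i : ZMod n) = j := by
  constructor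
  · intro e
    have e' : X (i + ((X j).2 - (X i).2) * n) = X j := by
      rw [h.add_mul_period]
      ext
      · exact e
      · simp [shift]
    have := h.strictMono.injective (congrArg A.left e')
    rw [← this]
    simp
  · intro e
    obtain ⟨k, hk⟩ := (ZMod.intCast_eq_intCast_iff_dvd_sub _ _ _).mp e
    rw [show j = i + k * n by linarith, h.add_mul_period]
    rfl

/-- In a shortest chain only consecutive lifts overlap. -/
theorem right_lt_left_of_minimal (h : A.IsPeriodicChain Vm n X)
    (hmin : ∀ m Y, A.IsPeriodicChain Vm m Y → n ≤ m) (i d : ℤ) (hd : 2 ≤ d) :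
    A.right (X i) < A.left (X (i + d)) := by
  rcases le_or_gt (n : ℤ) d with hdn | hdn
  · have h1 : A.left (X (i + n)) ≤ A.left (X (i + d)) := h.strictMono.monotone (by omega)
    rw [h.add_period, left_shift] at h1
    push_cast at h1
    linarith [A.right_lt_left_add (X i)]
  · by_contra! hle
    obtain ⟨e, rfl⟩ : ∃ e : ℕ, d = e := ⟨d.toNat, by omega⟩
    have hen : e < n := by exact_mod_cast hdn
    obtain ⟨Y, hY⟩ := exists_periodicChain_of_finite_chain (A := A) (Vm := Vm)
      (n := n - e + 1) (Nat.succ_pos _)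
      (fun r => if r = 0 then X i else X (i + e + r - 1))
      (fun r _ => by split_ifs <;> exact h.notMem _)
      (fun r _ => by
        by_cases hr : r = 0
        · subst hr
          simpa using h.strictMono (show i < i + (e : ℤ) by omega)
        · simp only [hr, if_false, Nat.succ_ne_zero]
          exact h.strictMono (by push_cast; omega))
      (fun r _ => by
        by_cases hr : r = 0
        · subst hr
          simpa using hle
        · simp only [hr, if_false, Nat.succ_ne_zero]
          have := h.left_le_right (i + e + r - 1)
          convert this using 3
          push_cast
          ring)
      (by
        simp only [Nat.succ_ne_zero, if_false, if_true]
        rw [← h.add_period]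
        congr 1
        push_cast [hen.le]
        ring)
    have := hmin _ _ hY
    omega

/-- A shortest chain of length at least four runs along a hole. -/
theorem hasHole_of_minimal (h : A.IsPeriodicChain Vm n X)
    (hmin : ∀ m Y, A.IsPeriodicChain Vm m Y → n ≤ m) (hn : 4 ≤ n) {G : SimpleGraph V}
    (hm : A.IsModelOf G) : (G.induce {v | v ∉ Vm}).HasHole := by
  have : Fact (1 < n) := ⟨by omega⟩
  have hcast : ∀ a : ZMod n, ((a.cast : ℤ) : ZMod n) = a := fun a => by simp
  have hinj : ∀ a b : ZMod n, (X a.cast).1 = (X b.cast).1 → a = b := fun a b e => by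
    have := (h.fst_eq_iff _ _).mp e
    rwa [hcast, hcast] at this
  have hnext : ∀ a : ZMod n, G.Adj (X a.cast).1 (X (a + 1).cast).1 := by
    intro a
    refine (hm.2 _ _ fun e => ?_).mpr ?_
    · have := hinj _ _ e
      simp at this
    · have e : (X (a + 1).cast).1 = (X (a.cast + 1)).1 := (h.fst_eq_iff _ _).mpr (by simp)
      rw [e, A.arc_inter_nonempty_iff]
      refine ⟨0, ?_, ?_⟩
      · simpa [right_shift] using ((h.left_lt a.cast).trans (A.left_lt_right _)).le
      · simpa [left_shift] using h.left_le_right a.cast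
  refine ⟨n, fun a => ⟨(X a.cast).1, h.notMem _⟩, hn,
    fun a b e => hinj a b (congrArg Subtype.val e), fun a b => ⟨fun e => ?_, ?_⟩⟩
  · replace e : G.Adj (X a.cast).1 (X b.cast).1 := e
    obtain ⟨m, h1, h2⟩ := (A.arc_inter_nonempty_iff _ _).mp ((hm.2 _ _ e.ne).mp e)
    rw [← h.add_mul_period] at h1 h2
    have d1 : (b.cast + m * n : ℤ) < a.cast + 2 := by
      by_contra! hd
      have := h.right_lt_left_of_minimal hmin a.cast (b.cast + m * n - a.cast) (by omega)
      rw [show (a.cast + (b.cast + m * n - a.cast) : ℤ) = b.cast + m * n by ring] at this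
      linarith
    have d2 : (a.cast : ℤ) < b.cast + m * n + 2 := by
      by_contra! hd
      have := h.right_lt_left_of_minimal hmin (b.cast + m * n)
        (a.cast - (b.cast + m * n)) (by omega)
      rw [show (b.cast + m * n + (a.cast - (b.cast + m * n)) : ℤ) = a.cast by ring] at this
      linarith
    have hb : ((b.cast + m * n : ℤ) : ZMod n) = b := by simp
    rcases (by omega : (b.cast + m * n : ℤ) = a.cast ∨ (b.cast + m * n : ℤ) = a.cast + 1 ∨
        (a.cast : ℤ) = (b.cast + m * n) + 1) with hd | hd | hd
    · have : b = a := by rw [← hb, hd, hcast]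
      exact absurd (this ▸ rfl) e.ne
    · right
      rw [← hb, hd, Int.cast_add, hcast, Int.cast_one]
    · left
      rw [← hcast a, hd, Int.cast_add, hb, Int.cast_one]
  · rintro (rfl | rfl)
    · exact (hnext b).symm
    · exact hnext a

/-- A chain of two lifts consists of two arcs covering the circle; a chain has no fewer, and with
the Helly property a shortest one never has exactly three. -/
theorem four_le_of_minimal (h : A.IsPeriodicChain Vm n X)
    (hmin : ∀ m Y, A.IsPeriodicChain Vm m Y → n ≤ m) {G : SimpleGraph V}
    (hm : A.IsModelOf G) (hproper : A.Proper) (hhelly : A.Helly) (hnc : ¬ G.Chordal) :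
    4 ≤ n := by
  have hpos := h.pos
  have s0 := h.left_lt 0
  have s1 := h.left_lt 1
  have s2 := h.left_lt 2
  have r0 := h.left_le_right 0
  have r1 := h.left_le_right 1
  have r2 := h.left_le_right 2
  have hp := h.add_period 0
  norm_num at s0 s1 s2 r0 r1 r2 hp
  by_contra! hlt
  interval_cases n
  · norm_num at hp
    rw [hp, left_shift] at r0
    push_cast at r0
    linarith [A.right_lt_left_add (X 0)]
  · norm_num at hp
    rw [hp, left_shift] at r1 s1
    push_cast at r1 s1
    exact hnc (hm.chordal_of_two_cover hproper hhelly s0 r0 (by linarith) (by linarith))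
  · norm_num at hp
    have hp1 := h.add_period 1
    have t0 := h.right_lt_left_of_minimal hmin 0 2 le_rfl
    have t1 := h.right_lt_left_of_minimal hmin 1 2 le_rfl
    have t2 := h.right_lt_left_of_minimal hmin 2 2 le_rfl
    norm_num at hp1 t0 t1 t2
    rw [hp, left_shift] at r2 s2 t1
    rw [hp1, left_shift] at t2
    push_cast at r2 s2 t1 t2
    have i01 : (A.arc (X 0).1 ∩ A.arc (X 1).1).Nonempty :=
      (A.arc_inter_nonempty_iff _ _).mpr ⟨0, by
        simpa [right_shift] using (s0.trans (A.left_lt_right _)).le, by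
        simpa [left_shift] using r0⟩
    have i12 : (A.arc (X 1).1 ∩ A.arc (X 2).1).Nonempty :=
      (A.arc_inter_nonempty_iff _ _).mpr ⟨0, by
        simpa [right_shift] using (s1.trans (A.left_lt_right _)).le, by
        simpa [left_shift] using r1⟩
    have i20 : (A.arc (X 2).1 ∩ A.arc (X 0).1).Nonempty :=
      (A.arc_inter_nonempty_iff _ _).mpr ⟨1, by
        simpa [right_shift] using (s2.trans (by linarith [A.left_lt_right (X 0)])).le, by
        simpa [left_shift] using r2⟩
    have self : ∀ w, (A.arc w ∩ A.arc w).Nonempty := fun w => by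
      rw [Set.inter_self]
      exact ⟨_, A.coe_mem_arc_of_mem (w, 0) le_rfl (A.left_lt_right _).le⟩
    have hpair : ∀ a ∈ ({(X 0).1, (X 1).1, (X 2).1} : Set V),
        ∀ b ∈ ({(X 0).1, (X 1).1, (X 2).1} : Set V), (A.arc a ∩ A.arc b).Nonempty := by
      rintro a (rfl | rfl | rfl) b (rfl | rfl | rfl) <;>
        first | exact self _ | assumption | (rw [Set.inter_comm]; assumption)
    obtain ⟨p, hp⟩ := hhelly _ hpair
    simp only [Set.mem_iInter] at hp
    obtain ⟨t, rfl⟩ := QuotientAddGroup.mk_surjective p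
    obtain ⟨a, ha1, ha2⟩ := (A.coe_mem_arc (X 0) t).mp (hp _ (by simp))
    obtain ⟨b, hb1, hb2⟩ := (A.coe_mem_arc (X 1) t).mp (hp _ (by simp))
    obtain ⟨c, hc1, hc2⟩ := (A.coe_mem_arc (X 2) t).mp (hp _ (by simp))
    have ab1 : a < b + 1 := A.int_lt_of_mul_lt (by push_cast; linarith)
    have ab2 : b < a + 1 := A.int_lt_of_mul_lt (by push_cast; linarith [A.right_lt_left_add (X 0)])
    obtain rfl : a = b := by omega
    have c1 : c < a := A.int_lt_of_mul_lt (by linarith)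
    have c2 : a < c + 1 := A.int_lt_of_mul_lt (by push_cast; linarith)
    omega

end IsPeriodicChain

end PreArcModel

/-- In a proper and Helly arc model of a non-chordal graph, a vertex set
is a hole cover iff it contains `K_A(α)` for some point `α`. -/
theorem stmt7 {V : Type*} [Fintype V] (G : SimpleGraph V) (A : PreArcModel V)
    (hm : A.IsModelOf G) (hproper : A.Proper) (hhelly : A.Helly) (hnc : ¬ G.Chordal)
    (Vm : Set V) :
    (G.induce {v | v ∉ Vm}).Chordal ↔ ∃ α : AddCircle A.L, A.K α ⊆ Vm := by
  refine ⟨fun hch => ?_, fun ⟨α, hα⟩ => hm.chordal_induce_of_K_subset hα⟩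
  by_contra! hno
  have hcov : ∀ α : AddCircle A.L, ∃ v ∉ Vm, α ∈ A.arc v := fun α => by
    obtain ⟨v, hv, hv'⟩ := Set.not_subset.mp (hno α)
    exact ⟨v, hv', hv⟩
  classical
  have hex := hproper.exists_periodicChain hcov
  obtain ⟨X, hX⟩ := Nat.find_spec hex
  have hmin : ∀ m Y, A.IsPeriodicChain Vm m Y → Nat.find hex ≤ m := fun m Y hY =>
    Nat.find_min' hex ⟨Y, hY⟩
  exact hch (hX.hasHole_of_minimal hmin (hX.four_le_of_minimal hmin hm hproper hhelly hnc) hm)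
end

section
/- Let A be a proper and Helly arc model for a non-chordal graph G. For any point α of the circle, the graph G − E→_A(α), obtained from G by deleting all edges of E→_A(α), is a unit interval graph. -/
/-- A finite family of real intervals `[l v, r v]` with distinct left endpoints, none of which
contains another, has the same intersection pattern as a family of unit intervals. -/
theorem exists_unit_representation {V : Type*} (l r : V → ℝ) (hinj : Function.Injective l)
    (hmono : ∀ u v, l u < l v → r u < r v) (s : Finset V) :
    ∃ f : V → ℝ, ∀ u ∈ s, ∀ v ∈ s, l u < l v →
      f u < f v ∧ (l v ≤ r u → f v < f u + 1) ∧ (r u < l v → f u + 1 < f v) := by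
  classical
  induction s using Finset.induction_on_max_value l with
  | empty => exact ⟨fun _ => 0, by simp⟩
  | insert a s ha hmax ih =>
    obtain ⟨f, hf⟩ := ih
    have hlt : ∀ x ∈ s, l x < l a := fun x hx =>
      lt_of_le_of_ne (hmax x hx) fun h => ha (hinj h ▸ hx)
    obtain ⟨m, hlo, hhi⟩ := Order.exists_between_finsets
      (s.image f ∪ (s.filter fun u => r u < l a).image fun u => f u + 1)
      ((s.filter fun u => l a ≤ r u).image fun u => f u + 1) (by
        intro x hx y hy
        simp only [Finset.mem_union, Finset.mem_image, Finset.mem_filter] at hx hy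
        obtain ⟨w, ⟨hw, hwr⟩, rfl⟩ := hy
        rcases hx with ⟨u, hu, rfl⟩ | ⟨u, ⟨hu, hur⟩, rfl⟩
        · rcases lt_trichotomy (l u) (l w) with h | h | h
          · linarith [(hf u hu w hw h).1]
          · rw [hinj h]; linarith
          · exact (hf w hw u hu h).2.1 ((hlt u hu).le.trans hwr)
        · rcases lt_trichotomy (l u) (l w) with h | h | h
          · linarith [(hf u hu w hw h).1]
          · rw [hinj h] at hur; linarith
          · linarith [hmono w u h])
    have hm₁ : ∀ u ∈ s, f u < m := fun u hu => hlo _ (by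
      simp only [Finset.mem_union, Finset.mem_image]; exact Or.inl ⟨u, hu, rfl⟩)
    have hm₂ : ∀ u ∈ s, r u < l a → f u + 1 < m := fun u hu h => hlo _ (by
      simp only [Finset.mem_union, Finset.mem_image, Finset.mem_filter]
      exact Or.inr ⟨u, ⟨hu, h⟩, rfl⟩)
    have hm₃ : ∀ u ∈ s, l a ≤ r u → m < f u + 1 := fun u hu h => hhi _ (by
      simp only [Finset.mem_image, Finset.mem_filter]; exact ⟨u, ⟨hu, h⟩, rfl⟩)
    refine ⟨Function.update f a m, fun u hu v hv huv => ?_⟩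
    have hne : ∀ x ∈ s, Function.update f a m x = f x := fun x hx =>
      Function.update_of_ne (by rintro rfl; exact ha hx) _ _
    rcases Finset.mem_insert.1 hu with rfl | hus
    · rcases Finset.mem_insert.1 hv with rfl | hvs
      · exact absurd huv (lt_irrefl _)
      · exact absurd huv (hlt v hvs).asymm
    · rcases Finset.mem_insert.1 hv with rfl | hvs
      · rw [hne u hus, Function.update_self]
        exact ⟨hm₁ u hus, hm₃ u hus, hm₂ u hus⟩
      · rw [hne u hus, hne v hvs]
        exact hf u hus v hvs huv

/-- The intersection graph of a finite family of real intervals with distinct left endpoints,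
none of which contains another, is a unit interval graph. -/
theorem SimpleGraph.isUnitIntervalGraph_of_proper {V : Type*} [Finite V] {G : SimpleGraph V}
    {l r : V → ℝ} (hinj : Function.Injective l) (hmono : ∀ u v, l u < l v → r u < r v)
    (hG : ∀ u v, l u < l v → (G.Adj u v ↔ l v ≤ r u)) : G.IsUnitIntervalGraph := by
  cases nonempty_fintype V
  obtain ⟨f, hf⟩ := exists_unit_representation l r hinj hmono Finset.univ
  have key : ∀ u v, l u < l v → (G.Adj u v ↔ |f u - f v| ≤ 1) := by
    intro u v h
    obtain ⟨h₁, h₂, h₃⟩ := hf u (Finset.mem_univ _) v (Finset.mem_univ _) h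
    rw [hG u v h, abs_sub_comm, abs_of_pos (sub_pos.2 h₁)]
    refine ⟨fun h => by linarith [h₂ h], fun h => ?_⟩
    by_contra! hc
    linarith [h₃ hc]
  refine ⟨f, fun u v huv => ?_⟩
  rcases lt_or_gt_of_ne (hinj.ne huv) with h | h
  · exact key u v h
  · rw [G.adj_comm, abs_sub_comm]
    exact key v u h

theorem SimpleGraph.HasHole.exists_path {V : Type*} {G : SimpleGraph V} (h : G.HasHole) :
    ∃ w₀ w₁ w₂ w₃ : V, w₀ ≠ w₂ ∧ w₁ ≠ w₃ ∧ ¬ G.Adj w₀ w₂ ∧ ¬ G.Adj w₁ w₃ ∧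
      G.Adj w₀ w₁ ∧ G.Adj w₁ w₂ ∧ G.Adj w₂ w₃ := by
  obtain ⟨n, f, hn, hinj, hadj⟩ := h
  have hne : ∀ k : ℕ, 0 < k → k < n → (k : ZMod n) ≠ 0 := fun k h₀ hk h =>
    absurd (Nat.le_of_dvd h₀ ((ZMod.natCast_eq_zero_iff k n).1 h)) (by omega)
  have h1 : (1 : ZMod n) ≠ 0 := by simpa using hne 1 (by omega) (by omega)
  have h2 : (2 : ZMod n) ≠ 0 := by simpa using hne 2 (by omega) (by omega)
  have h3 : (3 : ZMod n) ≠ 0 := by simpa using hne 3 (by omega) (by omega)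
  refine ⟨f 0, f 1, f 2, f 3, hinj.ne h2.symm, hinj.ne fun h => h2 (by linear_combination -h), ?_, ?_, ?_, ?_, ?_⟩
  all_goals rw [hadj]
  · rintro (h | h)
    · exact h3 (by linear_combination -h)
    · exact h1 (by linear_combination h)
  · rintro (h | h)
    · exact h3 (by linear_combination -h)
    · exact h1 (by linear_combination h)
  · exact Or.inr (by ring)
  · exact Or.inr (by ring)
  · exact Or.inr (by ring)

namespace PreArcModel

variable {V : Type*} {A : PreArcModel V}

theorem coe_add_intCast_mul (y : ℝ) (k : ℤ) :
    ((y + k * A.L : ℝ) : AddCircle A.L) = (y : AddCircle A.L) := by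
  refine QuotientAddGroup.eq_iff_sub_mem.2 ?_
  exact AddSubgroup.mem_zmultiples_iff.2 ⟨k, by simp⟩

theorem exists_coe_eq {x y : ℝ} (h : (x : AddCircle A.L) = (y : AddCircle A.L)) :
    ∃ k : ℤ, x = y + k * A.L := by
  obtain ⟨k, hk⟩ := AddSubgroup.mem_zmultiples_iff.1 (QuotientAddGroup.eq_iff_sub_mem.1 h)
  exact ⟨k, by simp at hk; linarith⟩

theorem exists_lift_mem_Ico (z : AddCircle A.L) (a : ℝ) :
    ∃ y : ℝ, (y : AddCircle A.L) = z ∧ a ≤ y ∧ y < a + A.L := by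
  obtain ⟨y, rfl⟩ := QuotientAddGroup.mk_surjective z
  obtain ⟨m, hm, -⟩ := existsUnique_add_zsmul_mem_Ico A.L_pos y a
  rw [zsmul_eq_mul] at hm
  exact ⟨_, coe_add_intCast_mul y m, hm.1, hm.2⟩

theorem exists_lift_mem_Ioc (z : AddCircle A.L) (a : ℝ) :
    ∃ y : ℝ, (y : AddCircle A.L) = z ∧ a < y ∧ y ≤ a + A.L := by
  obtain ⟨y, rfl⟩ := QuotientAddGroup.mk_surjective z
  obtain ⟨m, hm, -⟩ := existsUnique_add_zsmul_mem_Ioc A.L_pos y a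
  rw [zsmul_eq_mul] at hm
  exact ⟨_, coe_add_intCast_mul y m, hm.1, hm.2⟩

theorem mem_arc_iff {v : V} {p : ℝ} (hp : (p : AddCircle A.L) = A.ccp v) (y : ℝ) :
    (y : AddCircle A.L) ∈ A.arc v ↔ ∃ k : ℤ, p ≤ y + k * A.L ∧ y + k * A.L ≤ p + A.len v := by
  obtain ⟨m, rfl⟩ := exists_coe_eq hp
  constructor
  · rintro ⟨x, ⟨h₁, h₂⟩, hx⟩
    obtain ⟨k, rfl⟩ := exists_coe_eq hx
    exact ⟨k + m, by push_cast; linarith, by push_cast; linarith⟩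
  · rintro ⟨k, h₁, h₂⟩
    refine ⟨y + (k - m : ℤ) * A.L, ⟨?_, ?_⟩, coe_add_intCast_mul _ _⟩ <;> push_cast <;> linarith

theorem coe_mem_arc_s8 {v : V} {p : ℝ} (hp : (p : AddCircle A.L) = A.ccp v) {y : ℝ} (h₁ : p ≤ y)
    (h₂ : y ≤ p + A.len v) : (y : AddCircle A.L) ∈ A.arc v :=
  (mem_arc_iff hp y).2 ⟨0, by simpa using h₁, by simpa using h₂⟩

theorem exists_lift_of_mem_arc {v : V} {p : ℝ} (hp : (p : AddCircle A.L) = A.ccp v)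
    {z : AddCircle A.L} (hz : z ∈ A.arc v) :
    ∃ y : ℝ, (y : AddCircle A.L) = z ∧ p ≤ y ∧ y ≤ p + A.len v := by
  obtain ⟨y, rfl⟩ := QuotientAddGroup.mk_surjective z
  obtain ⟨k, h₁, h₂⟩ := (mem_arc_iff hp y).1 hz
  exact ⟨_, coe_add_intCast_mul y k, h₁, h₂⟩

theorem cp_eq {v : V} {p : ℝ} (hp : (p : AddCircle A.L) = A.ccp v) :
    A.cp v = ((p + A.len v : ℝ) : AddCircle A.L) := by
  obtain ⟨m, rfl⟩ := exists_coe_eq hp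
  rw [cp, ← coe_add_intCast_mul (A.src v + A.len v) m]
  congr 1
  ring

theorem L_le_intCast_mul {k : ℤ} (hk : 1 ≤ k) : A.L ≤ k * A.L := by
  have : (1 : ℝ) ≤ k := by exact_mod_cast hk
  nlinarith [A.L_pos]

theorem intCast_mul_le_neg_L {k : ℤ} (hk : k ≤ -1) : k * A.L ≤ -A.L := by
  have : (k : ℝ) ≤ -1 := by exact_mod_cast hk
  nlinarith [A.L_pos]

theorem arc_inter_nonempty_iff_s8 {u v : V} {p q : ℝ} (hp : (p : AddCircle A.L) = A.ccp u)
    (hq : (q : AddCircle A.L) = A.ccp v) : (A.arc u ∩ A.arc v).Nonempty ↔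
      ∃ k : ℤ, p + k * A.L ≤ q + A.len v ∧ q ≤ p + k * A.L + A.len u := by
  constructor
  · rintro ⟨z, hu, hv⟩
    obtain ⟨y, rfl, h₁, h₂⟩ := exists_lift_of_mem_arc hp hu
    obtain ⟨k, h₃, h₄⟩ := (mem_arc_iff hq y).1 hv
    exact ⟨k, by linarith, by linarith⟩
  · rintro ⟨k, h₁, h₂⟩
    have hp' := (coe_add_intCast_mul p k).trans hp
    refine ⟨((max (p + k * A.L) q : ℝ) : AddCircle A.L),
      coe_mem_arc_s8 hp' (le_max_left _ _) ?_, coe_mem_arc_s8 hq (le_max_right _ _) ?_⟩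
    · exact max_le (by linarith [A.len_pos u]) h₂
    · exact max_le h₁ (by linarith [A.len_pos v])

theorem arc_subset_of_lift {u v : V} {p q : ℝ} (hp : (p : AddCircle A.L) = A.ccp u)
    (hq : (q : AddCircle A.L) = A.ccp v) (h₁ : q ≤ p) (h₂ : p + A.len u ≤ q + A.len v) :
    A.arc u ⊆ A.arc v := by
  intro z hz
  obtain ⟨y, rfl, h₃, h₄⟩ := exists_lift_of_mem_arc hp hz
  exact coe_mem_arc_s8 hq (h₁.trans h₃) (h₄.trans h₂)

theorem ccp_eq_of_arc_eq {u v : V} (h : A.arc u = A.arc v) : A.ccp u = A.ccp v := by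
  have hp : ((A.src u : ℝ) : AddCircle A.L) = A.ccp u := rfl
  have hsrc : A.ccp u ∈ A.arc v := h ▸ coe_mem_arc_s8 hp le_rfl (by linarith [A.len_pos u])
  obtain ⟨p, hpu, h₁, h₂⟩ := exists_lift_of_mem_arc (p := A.src v) rfl hsrc
  rcases h₁.eq_or_lt with rfl | hlt
  · exact hpu.symm
  exfalso
  have hmem : ((A.src v : ℝ) : AddCircle A.L) ∈ A.arc u :=
    h ▸ coe_mem_arc_s8 rfl le_rfl (by linarith [A.len_pos v])
  obtain ⟨j, h₃, h₄⟩ := (mem_arc_iff hpu _).1 hmem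
  have hj : 1 ≤ j := by
    by_contra! hc
    have : (j : ℝ) ≤ 0 := by exact_mod_cast (by omega : j ≤ 0)
    nlinarith [A.L_pos]
  have hjL := L_le_intCast_mul (A := A) hj
  have hlen := A.len_lt v
  obtain ⟨y, hy₁, hy₂⟩ := exists_between (show A.src v + A.len v < A.src v + A.L by linarith)
  have hy : (y : AddCircle A.L) ∈ A.arc v :=
    h ▸ coe_mem_arc_s8 hpu (by linarith) (by linarith)
  obtain ⟨k, h₅, h₆⟩ := (mem_arc_iff (p := A.src v) rfl y).1 hy
  rcases le_or_gt k (-1) with hk | hk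
  · linarith [intCast_mul_le_neg_L (A := A) hk]
  · have : (0 : ℝ) ≤ k := by exact_mod_cast (by omega : 0 ≤ k)
    nlinarith [A.L_pos]

theorem EndpointsDistinct.ccp_injective (h : A.EndpointsDistinct) : Function.Injective A.ccp :=
  fun u v huv => congrArg Prod.fst (h (a₁ := (u, false)) (a₂ := (v, false)) (by simpa using huv))

theorem Proper.not_arc_subset (h : A.Proper) (he : A.EndpointsDistinct) {u v : V} (huv : u ≠ v) :
    ¬ A.arc u ⊆ A.arc v := fun hs =>
  h u v ⟨hs, fun hs' => huv (he.ccp_injective (ccp_eq_of_arc_eq (hs.antisymm hs')))⟩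

/-- Suppose that each set of a family contains `I` or `J`, and that any two intersecting sets of
the family have a common point in `I ∪ J`. Then the intersection pattern of the family has no
induced path, or four-cycle, `w₀ w₁ w₂ w₃` with `w₀` on the side of `I`. -/
theorem false_of_path {X : Type*} {s : V → Set X} {I J : Set X} {w₀ w₁ w₂ w₃ : V}
    (hI : I.Nonempty) (hsub : ∀ x, I ⊆ s x ∨ J ⊆ s x)
    (hcommon : ∀ x y, (s x ∩ s y).Nonempty → (s x ∩ s y ∩ (I ∪ J)).Nonempty)
    (h02 : ¬ (s w₀ ∩ s w₂).Nonempty) (h13 : ¬ (s w₁ ∩ s w₃).Nonempty)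
    (h12 : (s w₁ ∩ s w₂).Nonempty) (h23 : (s w₂ ∩ s w₃).Nonempty) (h0 : I ⊆ s w₀) : False := by
  have hmeet : ∀ x, (s x ∩ s w₂).Nonempty → ∃ z ∈ s x, z ∈ J := by
    intro x hx
    obtain ⟨z, ⟨hzx, hz2⟩, hz | hz⟩ := hcommon x w₂ hx
    · exact absurd ⟨z, h0 hz, hz2⟩ h02
    · exact ⟨z, hzx, hz⟩
  obtain ⟨z₁, hz₁, hz₁J⟩ := hmeet w₁ h12
  obtain ⟨z₃, hz₃, hz₃J⟩ := hmeet w₃ (by rwa [Set.inter_comm])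
  rcases hsub w₁ with h1 | h1
  · rcases hsub w₃ with h3 | h3
    · obtain ⟨z, hz⟩ := hI
      exact h13 ⟨z, h1 hz, h3 hz⟩
    · exact h13 ⟨z₁, hz₁, h3 hz₁J⟩
  · exact h13 ⟨z₃, h1 hz₃J, hz₃⟩

/-- In a proper Helly model of a graph with a hole, no two arcs overlap at both ends. -/
theorem not_overlap_both_ends {G : SimpleGraph V} (hm : A.IsModelOf G) (hproper : A.Proper)
    (hhelly : A.Helly) (hole : G.HasHole) {u v : V} (huv : u ≠ v) {a c : ℝ}
    (ha : (a : AddCircle A.L) = A.ccp u) (hc : (c : AddCircle A.L) = A.ccp v)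
    (hac : a + A.L ≤ c + A.len v) : ¬ c ≤ a + A.len u := by
  intro hca
  have hlu := A.len_lt u
  have hlv := A.len_lt v
  set I : Set (AddCircle A.L) := (fun y : ℝ => (y : AddCircle A.L)) '' Set.Icc a (c + A.len v - A.L)
  set J : Set (AddCircle A.L) := (fun y : ℝ => (y : AddCircle A.L)) '' Set.Icc c (a + A.len u)
  have hshift : ∀ y : ℝ, ((y + A.L : ℝ) : AddCircle A.L) = y := fun y => by simp
  have hI : I.Nonempty := ⟨_, a, ⟨le_rfl, by linarith⟩, rfl⟩
  have hJ : J.Nonempty := ⟨_, c, ⟨le_rfl, hca⟩, rfl⟩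
  have hsub : ∀ x, I ⊆ A.arc x ∨ J ⊆ A.arc x := by
    intro x
    have hIu : I ⊆ A.arc u := by
      rintro _ ⟨y, ⟨h₁, h₂⟩, rfl⟩
      exact coe_mem_arc_s8 ha h₁ (by linarith)
    have hJv : J ⊆ A.arc v := by
      rintro _ ⟨y, ⟨h₁, h₂⟩, rfl⟩
      exact coe_mem_arc_s8 hc h₁ (by linarith)
    by_cases hxu : x = u
    · exact Or.inl (hxu ▸ hIu)
    by_cases hxv : x = v
    · exact Or.inr (hxv ▸ hJv)
    obtain ⟨p, hp, hap, hpa⟩ := exists_lift_mem_Ico (A.ccp x) a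
    have h₁ : a + A.len u < p + A.len x := by
      by_contra! h
      exact hproper.not_arc_subset hm.1 hxu (arc_subset_of_lift hp ha hap h)
    rcases le_or_gt p c with h₂ | h₂
    · right
      rintro _ ⟨y, ⟨h₃, h₄⟩, rfl⟩
      exact coe_mem_arc_s8 hp (h₂.trans h₃) (by linarith)
    · left
      have h₅ : c + A.len v < p + A.len x := by
        by_contra! h
        exact hproper.not_arc_subset hm.1 hxv (arc_subset_of_lift hp hc h₂.le h)
      rintro _ ⟨y, ⟨h₃, h₄⟩, rfl⟩
      simp only
      rw [← hshift y]
      exact coe_mem_arc_s8 hp (by linarith) (by linarith)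
  have hIu : I ⊆ A.arc u ∩ A.arc v := by
    rintro _ ⟨y, ⟨h₁, h₂⟩, rfl⟩
    refine ⟨coe_mem_arc_s8 ha h₁ (by linarith), ?_⟩
    simp only
    rw [← hshift y]
    exact coe_mem_arc_s8 hc (by linarith) (by linarith)
  have hJu : J ⊆ A.arc u ∩ A.arc v := by
    rintro _ ⟨y, ⟨h₁, h₂⟩, rfl⟩
    exact ⟨coe_mem_arc_s8 ha (by linarith) h₂, coe_mem_arc_s8 hc h₁ (by linarith)⟩
  have hIJ : A.arc u ∩ A.arc v ⊆ I ∪ J := by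
    rintro z ⟨hzu, hzv⟩
    obtain ⟨y, rfl, h₁, h₂⟩ := exists_lift_of_mem_arc ha hzu
    obtain ⟨k, h₃, h₄⟩ := (mem_arc_iff hc y).1 hzv
    have hk₀ : ¬ k ≤ -1 := fun hk => by linarith [intCast_mul_le_neg_L (A := A) hk]
    have hk₂ : ¬ 2 ≤ k := fun hk => by
      have := L_le_intCast_mul (A := A) (k := k - 1) (by omega)
      push_cast at this
      linarith
    obtain rfl | rfl : k = 0 ∨ k = 1 := by omega
    · exact Or.inr ⟨y, ⟨by simpa using h₃, h₂⟩, rfl⟩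
    · exact Or.inl ⟨y, ⟨h₁, by push_cast at h₄; linarith⟩, rfl⟩
  have hmeet : ∀ x, (A.arc x ∩ (A.arc u ∩ A.arc v)).Nonempty := by
    intro x
    rcases hsub x with h | h
    · exact hI.mono fun z hz => ⟨h hz, hIu hz⟩
    · exact hJ.mono fun z hz => ⟨h hz, hJu hz⟩
  have hmu : ∀ x, (A.arc x ∩ A.arc u).Nonempty := fun x => (hmeet x).mono fun z hz => ⟨hz.1, hz.2.1⟩
  have hmv : ∀ x, (A.arc x ∩ A.arc v).Nonempty := fun x => (hmeet x).mono fun z hz => ⟨hz.1, hz.2.2⟩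
  have hself : ∀ x, (A.arc x ∩ A.arc x).Nonempty := fun x => (hmeet x).mono fun z hz => ⟨hz.1, hz.1⟩
  have hcommon : ∀ x y, (A.arc x ∩ A.arc y).Nonempty →
      (A.arc x ∩ A.arc y ∩ (I ∪ J)).Nonempty := by
    intro x y hxy
    have hyx : (A.arc y ∩ A.arc x).Nonempty := by rwa [Set.inter_comm]
    obtain ⟨z, hz⟩ := hhelly {x, y, u, v} (by
      rintro s (rfl | rfl | rfl | rfl) t (rfl | rfl | rfl | rfl) <;>
        first
          | assumption
          | exact hself _
          | exact hmu _
          | exact hmv _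
          | exact Set.inter_comm _ _ ▸ hmu _
          | exact Set.inter_comm _ _ ▸ hmv _)
    simp only [Set.mem_iInter] at hz
    exact ⟨z, ⟨hz x (by simp), hz y (by simp)⟩, hIJ ⟨hz u (by simp), hz v (by simp)⟩⟩
  obtain ⟨w₀, w₁, w₂, w₃, n02, n13, h02, h13, h01, h12, h23⟩ := hole.exists_path
  rw [hm.2 _ _ n02] at h02
  rw [hm.2 _ _ n13] at h13
  rw [hm.2 _ _ h12.ne] at h12
  rw [hm.2 _ _ h23.ne] at h23
  rcases hsub w₀ with h0 | h0
  · exact false_of_path hI hsub hcommon h02 h13 h12 h23 h0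
  · exact false_of_path hJ (fun x => (hsub x).symm)
      (fun x y h => Set.union_comm I J ▸ hcommon x y h) h02 h13 h12 h23 h0

theorem mem_arc_iff_of_lift {v : V} {x p : ℝ} (hp : (p : AddCircle A.L) = A.ccp v) (h₁ : x < p)
    (h₂ : p ≤ x + A.L) : (x : AddCircle A.L) ∈ A.arc v ↔ x + A.L ≤ p + A.len v := by
  rw [mem_arc_iff hp]
  constructor
  · rintro ⟨k, h₃, h₄⟩
    have hk : 1 ≤ k := by
      by_contra! hk
      have : (k : ℝ) ≤ 0 := by exact_mod_cast (by omega : k ≤ 0)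
      nlinarith [A.L_pos]
    linarith [L_le_intCast_mul (A := A) hk]
  · exact fun h => ⟨1, by simpa using h₂, by simpa using h⟩

theorem isUnitIntervalGraph_deleteEdges_Eout [Finite V] {G : SimpleGraph V} (hm : A.IsModelOf G)
    (hproper : A.Proper) (hhelly : A.Helly) (hole : G.HasHole) (α : AddCircle A.L) :
    (G.deleteEdges (A.Eout G α)).IsUnitIntervalGraph := by
  obtain ⟨x, rfl⟩ := QuotientAddGroup.mk_surjective α
  choose l hl hl₁ hl₂ using fun v => exists_lift_mem_Ioc (A.ccp v) x
  have hinj : Function.Injective l := fun u v h =>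
    hm.1.ccp_injective (by rw [← hl u, ← hl v, h])
  have hmono : ∀ u v, l u < l v → l u + A.len u < l v + A.len v := by
    intro u v h
    by_contra! hc
    exact hproper.not_arc_subset hm.1 (fun e => h.ne (congrArg l e.symm))
      (arc_subset_of_lift (hl v) (hl u) h.le hc)
  have hK : ∀ v, (x : AddCircle A.L) ∈ A.arc v ↔ x + A.L ≤ l v + A.len v := fun v =>
    mem_arc_iff_of_lift (hl v) (hl₁ v) (hl₂ v)
  refine SimpleGraph.isUnitIntervalGraph_of_proper (r := fun v => l v + A.len v) hinj hmono ?_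
  intro u v huv
  have hne : u ≠ v := fun e => huv.ne (congrArg l e)
  have hr := hmono u v huv
  have hu₁ := hl₁ u
  have hu₂ := hl₂ u
  have hv₁ := hl₁ v
  have hv₂ := hl₂ v
  have hlv := A.len_lt v
  have hlu := A.len_lt u
  rw [SimpleGraph.deleteEdges_adj, hm.2 u v hne, arc_inter_nonempty_iff_s8 (hl u) (hl v)]
  constructor
  · rintro ⟨⟨k, h₁, h₂⟩, hE⟩
    by_contra! hgap
    have hk₁ : 1 ≤ k := by
      by_contra! hk
      have : (k : ℝ) ≤ 0 := by exact_mod_cast (by omega : k ≤ 0)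
      nlinarith [A.L_pos]
    have hk := L_le_intCast_mul (A := A) hk₁
    have hadj : G.Adj v u := ((hm.2 u v hne).2
      ((arc_inter_nonempty_iff_s8 (hl u) (hl v)).2 ⟨k, h₁, h₂⟩)).symm
    refine hE ⟨v, u, Sym2.eq_swap, hadj, (hK v).2 (by linarith), fun h => ?_, ?_⟩
    · linarith [(hK u).1 h]
    · rw [cp_eq (hl v), mem_arc_iff (hl u)]
      refine ⟨-1, by push_cast; linarith, ?_⟩
      by_contra! hc
      push_cast at hc
      refine hproper.not_arc_subset hm.1 hne (arc_subset_of_lift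
        ((coe_add_intCast_mul (l u) 1).trans (hl u)) (hl v) ?_ ?_) <;> push_cast <;> linarith
  · intro h
    refine ⟨⟨0, by push_cast; linarith [A.len_pos v], by push_cast; linarith⟩, ?_⟩
    rintro ⟨v', u', he, -, hv', hu', hcp⟩
    rcases Sym2.eq_iff.1 he with ⟨rfl, rfl⟩ | ⟨rfl, rfl⟩
    · exact hu' ((hK _).2 (((hK _).1 hv').trans hr.le))
    · rw [hK, not_le] at hu'
      rw [cp_eq (hl _), mem_arc_iff (hl _)] at hcp
      obtain ⟨k, h₁, h₂⟩ := hcp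
      refine not_overlap_both_ends hm hproper hhelly hole hne (hl _) (hl _) ?_ h
      have hk : k ≤ -1 := by
        by_contra! hk
        have : (0 : ℝ) ≤ k := by exact_mod_cast (by omega : 0 ≤ k)
        nlinarith [A.L_pos]
      linarith [intCast_mul_le_neg_L (A := A) hk]

end PreArcModel

/-- Deleting the edge set `E→_A(α)` from a non-chordal graph with a proper
and Helly arc model yields a unit interval graph. -/
theorem stmt8 {V : Type*} [Fintype V] (G : SimpleGraph V) (A : PreArcModel V)
    (hm : A.IsModelOf G) (hproper : A.Proper) (hhelly : A.Helly) (hnc : ¬ G.Chordal)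
    (α : AddCircle A.L) :
    (G.deleteEdges (A.Eout G α)).IsUnitIntervalGraph := by
  exact PreArcModel.isUnitIntervalGraph_deleteEdges_Eout hm hproper hhelly (not_not.1 hnc) α
end
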